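/- Let X be the self-repelling random walk with directed edges and weight function w. Fix s > 0, and for A > 0 let θ_{s/A} be independent of X with geometric distribution Pr(θ_{s/A} = n) = (1 − e^{−s/A})·e^{−sn/A}. Then for every x ∈ ℝ, lim_{A→∞} Pr(A^{−1/2}·X(θ_{s/A}) < x) = ∫_{−∞}^x φ̂(s,y) dy, where φ̂(s,y) := √(sπ)·(1 − F(√(2s)·|y|)) and F is the standard normal cumulative distribution function. -/

import Mathlib

open MeasureTheory Filter
open scoped BigOperators ENNReal Topology

noncomputable section

/-- The weight function `w` is positive, nondecreasing and satisfies
`lim_{z→∞} (w(z) - w(-z)) > 0`. -/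
def GoodWeight (w : ℤ → ℝ) : Prop :=
  (∀ z, 0 < w z) ∧ (∀ z, w z ≤ w (z + 1)) ∧
    ∃ c > (0 : ℝ), ∀ᶠ z : ℤ in atTop, c ≤ w z - w (-z)

/-- Local time of the path `x` on the oriented edge from `k` to `k+1` up to time `n`. -/
def dirLocP (x : ℕ → ℤ) (n : ℕ) (k : ℤ) : ℕ :=
  ((Finset.range n).filter fun j => x j = k ∧ x (j + 1) = k + 1).card

/-- Local time of the path `x` on the oriented edge from `k` to `k-1` up to time `n`. -/
def dirLocM (x : ℕ → ℤ) (n : ℕ) (k : ℤ) : ℕ :=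
  ((Finset.range n).filter fun j => x j = k ∧ x (j + 1) = k - 1).card

/-- The conditional probability, given the past path `x` up to time `n`, that the
self-repelling walk with weight `w` makes the step `x n → x (n+1)`. -/
def stepProb (w : ℤ → ℝ) (x : ℕ → ℤ) (n : ℕ) : ℝ :=
  let Δ : ℤ := (dirLocP x n (x n) : ℤ) - (dirLocM x n (x n) : ℤ)
  if x (n + 1) = x n + 1 then w (-Δ) / (w Δ + w (-Δ))
  else if x (n + 1) = x n - 1 then w Δ / (w Δ + w (-Δ))
  else 0

/-- `X` is the self-repelling random walk with directed edges and weight function `w`: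
it starts at `0` and its cylinder probabilities evolve by the self-repelling
transition probabilities. -/
def IsSRW {Ω : Type*} [MeasurableSpace Ω] (μ : Measure Ω) (w : ℤ → ℝ)
    (X : ℕ → Ω → ℤ) : Prop :=
  (∀ n, Measurable (X n)) ∧
  μ {ω | X 0 ω = 0} = 1 ∧
  ∀ (n : ℕ) (x : ℕ → ℤ),
    μ {ω | ∀ i ≤ n + 1, X i ω = x i} =
      μ {ω | ∀ i ≤ n, X i ω = x i} * ENNReal.ofReal (stepProb w x n)

/-- Inverse local time `T⁺_{j,r} = min{n ≥ 0 : ℓ⁺(n,j) ≥ r}` of the path `x`. -/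
def Tp (x : ℕ → ℤ) (j : ℤ) (r : ℕ) : ℕ := sInf {n | r ≤ dirLocP x n j}

/-- Inverse local time `T⁻_{j,r} = min{n ≥ 0 : ℓ⁻(n,j) ≥ r}` of the path `x`. -/
def Tm (x : ℕ → ℤ) (j : ℤ) (r : ℕ) : ℕ := sInf {n | r ≤ dirLocM x n j}

/-- `Λ⁺_{j,r}(k) = ℓ⁺(T⁺_{j,r},k) + ℓ⁻(T⁺_{j,r},k+1)`. -/
def LamP (x : ℕ → ℤ) (j : ℤ) (r : ℕ) (k : ℤ) : ℕ :=
  dirLocP x (Tp x j r) k + dirLocM x (Tp x j r) (k + 1)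

/-- `Λ⁻_{j,r}(k) = ℓ⁺(T⁻_{j,r},k) + ℓ⁻(T⁻_{j,r},k+1)`. -/
def LamM (x : ℕ → ℤ) (j : ℤ) (r : ℕ) (k : ℤ) : ℕ :=
  dirLocP x (Tm x j r) k + dirLocM x (Tm x j r) (k + 1)

/-- Leftmost edge `λ⁺_{j,r}` visited before `T⁺_{j,r}`. -/
def lamEdgeP (x : ℕ → ℤ) (j : ℤ) (r : ℕ) : ℤ := sInf {k : ℤ | 0 < LamP x j r k}

/-- Leftmost edge `λ⁻_{j,r}` visited before `T⁻_{j,r}`. -/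
def lamEdgeM (x : ℕ → ℤ) (j : ℤ) (r : ℕ) : ℤ := sInf {k : ℤ | 0 < LamM x j r k}

/-- Rightmost edge `ρ⁺_{j,r}` visited before `T⁺_{j,r}`. -/
def rhoEdgeP (x : ℕ → ℤ) (j : ℤ) (r : ℕ) : ℤ := sSup {k : ℤ | 0 < LamP x j r k}

/-- Rightmost edge `ρ⁻_{j,r}` visited before `T⁻_{j,r}`. -/
def rhoEdgeM (x : ℕ → ℤ) (j : ℤ) (r : ℕ) : ℤ := sSup {k : ℤ | 0 < LamM x j r k}

/-- The standard normal cumulative distribution function `F`. -/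
def stdNormalCdf (x : ℝ) : ℝ :=
  (Real.sqrt (2 * Real.pi))⁻¹ * ∫ y in Set.Iic x, Real.exp (-(y ^ 2) / 2)

/-- `φ̂(s,x) = √(sπ) (1 - F(√(2s)|x|))`. -/
def phiHat (s x : ℝ) : ℝ :=
  Real.sqrt (s * Real.pi) * (1 - stdNormalCdf (Real.sqrt (2 * s) * |x|))

/-- Probability that the local chain at a site steps up from `z`. -/
def upProb (w : ℤ → ℝ) (z : ℤ) : ℝ := w (-z) / (w z + w (-z))

/-- Probability that the local chain at a site steps down from `z`. -/
def downProb (w : ℤ → ℝ) (z : ℤ) : ℝ := w z / (w z + w (-z))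

/-- `n`-step transition probabilities of the local chain. -/
def transProb (w : ℤ → ℝ) : ℕ → ℤ → ℤ → ℝ
  | 0, z, y => if z = y then 1 else 0
  | n + 1, z, y =>
    downProb w z * transProb w n (z - 1) y + upProb w z * transProb w n (z + 1) y

/-- Probability that the local chain started from `z` makes exactly `j` up steps before its
`d`-th down step. -/
def upLaw (w : ℤ → ℝ) : ℕ → ℤ → ℕ → ℝ
  | 0, _, j => if j = 0 then 1 else 0
  | d + 1, z, j => transProb w (d + j) z (z + j - d) * downProb w (z + j - d)

section LocalChain

variable {w : ℤ → ℝ}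

lemma upProb_pos (hw : ∀ z, 0 < w z) (z : ℤ) : 0 < upProb w z :=
  div_pos (hw _) (add_pos (hw _) (hw _))

lemma downProb_pos (hw : ∀ z, 0 < w z) (z : ℤ) : 0 < downProb w z :=
  div_pos (hw _) (add_pos (hw _) (hw _))

lemma downProb_add_upProb (hw : ∀ z, 0 < w z) (z : ℤ) : downProb w z + upProb w z = 1 := by
  have := (add_pos (hw z) (hw (-z))).ne'
  unfold downProb upProb
  field_simp

lemma downProb_neg (z : ℤ) : downProb w (-z) = upProb w z := by
  simp [downProb, upProb, add_comm]

lemma upProb_neg (z : ℤ) : upProb w (-z) = downProb w z := by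
  simp [downProb, upProb, add_comm]

lemma upProb_le_half (hw : ∀ z, 0 < w z) (hm : Monotone w) {z : ℤ} (hz : 0 ≤ z) :
    upProb w z ≤ 1 / 2 := by
  have h1 := hm (show -z ≤ z by omega)
  have := hw z
  have := hw (-z)
  unfold upProb
  rw [div_le_div_iff₀ (by positivity) (by norm_num)]
  linarith

lemma transProb_nonneg (hw : ∀ z, 0 < w z) (n : ℕ) (z y : ℤ) : 0 ≤ transProb w n z y := by
  induction n generalizing z with
  | zero => simp only [transProb]; split_ifs <;> norm_num
  | succ n ih =>
    have := ih (z - 1)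
    have := ih (z + 1)
    have := (downProb_pos hw z).le
    have := (upProb_pos hw z).le
    simp only [transProb]
    positivity

lemma transProb_le_one (hw : ∀ z, 0 < w z) (n : ℕ) (z y : ℤ) : transProb w n z y ≤ 1 := by
  induction n generalizing z with
  | zero => simp only [transProb]; split_ifs <;> norm_num
  | succ n ih =>
    have h1 := mul_le_of_le_one_right (downProb_pos hw z).le (ih (z - 1))
    have h2 := mul_le_of_le_one_right (upProb_pos hw z).le (ih (z + 1))
    have := downProb_add_upProb hw z
    simp only [transProb]
    linarith

lemma transProb_eq_zero_of_lt {n : ℕ} {z y : ℤ} (h : z + n < y) : transProb w n z y = 0 := by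
  induction n generalizing z with
  | zero => simp only [transProb]; rw [if_neg]; push_cast at h; omega
  | succ n ih =>
    push_cast at h
    simp only [transProb]
    rw [ih (by omega), ih (by omega)]; simp

lemma transProb_eq_zero_of_gt {n : ℕ} {z y : ℤ} (h : y < z - n) : transProb w n z y = 0 := by
  induction n generalizing z with
  | zero => simp only [transProb]; rw [if_neg]; push_cast at h; omega
  | succ n ih =>
    push_cast at h
    simp only [transProb]
    rw [ih (by omega), ih (by omega)]; simp

lemma transProb_succ_last (n : ℕ) (z y : ℤ) :
    transProb w (n + 1) z y =
      transProb w n z (y + 1) * downProb w (y + 1) +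
        transProb w n z (y - 1) * upProb w (y - 1) := by
  induction n generalizing z with
  | zero =>
    simp only [transProb]
    by_cases h1 : z = y + 1
    · subst h1; simp [show y + 1 ≠ y - 1 by omega, show y + 1 + 1 ≠ y by omega]
    · by_cases h2 : z = y - 1
      · subst h2; simp [show y - 1 ≠ y + 1 by omega, show y - 1 - 1 ≠ y by omega]
      · simp [h1, h2, show z - 1 ≠ y by omega, show z + 1 ≠ y by omega]
  | succ n ih =>
    rw [transProb, ih, ih]
    conv_rhs => rw [transProb, transProb]
    ring

lemma upLaw_nonneg (hw : ∀ z, 0 < w z) (d : ℕ) (z : ℤ) (j : ℕ) : 0 ≤ upLaw w d z j := by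
  cases d with
  | zero => simp only [upLaw]; split_ifs <;> norm_num
  | succ d => exact mul_nonneg (transProb_nonneg hw _ _ _) (downProb_pos hw _).le

lemma upLaw_succ_zero (d : ℕ) (z : ℤ) :
    upLaw w (d + 1) z 0 = downProb w z * upLaw w d (z - 1) 0 := by
  cases d with
  | zero => simp [upLaw, transProb]
  | succ d =>
    simp only [upLaw]
    rw [show d + 1 + 0 = (d + 0) + 1 by omega, transProb,
      transProb_eq_zero_of_gt (z := z + 1) (by push_cast; omega),
      show z + ((0 : ℕ) : ℤ) - ((d + 1 : ℕ) : ℤ) = z - 1 + ((0 : ℕ) : ℤ) - (d : ℤ) by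
        push_cast; omega]
    simp [mul_assoc]

lemma upLaw_succ_succ (d : ℕ) (z : ℤ) (j : ℕ) :
    upLaw w (d + 1) z (j + 1) =
      downProb w z * upLaw w d (z - 1) (j + 1) + upProb w z * upLaw w (d + 1) (z + 1) j := by
  cases d with
  | zero =>
    simp only [upLaw]
    rw [show 0 + (j + 1) = (0 + j) + 1 by omega, transProb,
      transProb_eq_zero_of_lt (z := z - 1) (by push_cast; omega),
      show z + ((j + 1 : ℕ) : ℤ) - ((0 : ℕ) : ℤ) = z + 1 + (j : ℤ) - ((0 : ℕ) : ℤ) by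
        push_cast; omega]
    simp [mul_assoc]
  | succ d =>
    simp only [upLaw]
    rw [show d + 1 + (j + 1) = (d + 1 + j) + 1 by omega, transProb,
      show z + ((j + 1 : ℕ) : ℤ) - ((d + 1 : ℕ) : ℤ) = z + 1 + (j : ℤ) - ((d + 1 : ℕ) : ℤ) by
        push_cast; omega,
      show z - 1 + ((j + 1 : ℕ) : ℤ) - (d : ℤ) = z + 1 + (j : ℤ) - ((d + 1 : ℕ) : ℤ) by
        push_cast; omega, show d + (j + 1) = d + 1 + j by omega]
    ring

lemma sum_range_upLaw_le_one (hw : ∀ z, 0 < w z) (d : ℕ) (z : ℤ) (N : ℕ) :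
    ∑ j ∈ Finset.range N, upLaw w d z j ≤ 1 := by
  induction d generalizing z N with
  | zero =>
    calc ∑ j ∈ Finset.range N, upLaw w 0 z j
        ≤ ∑ j ∈ Finset.range (N + 1), upLaw w 0 z j :=
          Finset.sum_le_sum_of_subset_of_nonneg (Finset.range_mono (Nat.le_succ _))
            fun _ _ _ => upLaw_nonneg hw _ _ _
      _ ≤ 1 := by simp [upLaw]
  | succ d ihd =>
    induction N generalizing z with
    | zero => simp
    | succ N ihN =>
      have h1 := mul_le_of_le_one_right (downProb_pos hw z).le (ihd (z - 1) (N + 1))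
      have h2 := mul_le_of_le_one_right (upProb_pos hw z).le (ihN (z + 1))
      have h3 := downProb_add_upProb hw z
      rw [Finset.sum_range_succ'] at h1 ⊢
      simp only [upLaw_succ_zero, upLaw_succ_succ, Finset.sum_add_distrib, ← Finset.mul_sum]
      linarith

lemma summable_upLaw (hw : ∀ z, 0 < w z) (d : ℕ) (z : ℤ) : Summable (upLaw w d z) :=
  summable_of_sum_range_le (upLaw_nonneg hw d z) (sum_range_upLaw_le_one hw d z)

lemma tsum_upLaw (hw : ∀ z, 0 < w z) (hm : Monotone w) (d : ℕ) (z : ℤ) :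
    ∑' j, upLaw w d z j = 1 := by
  induction d generalizing z with
  | zero => simp [upLaw]
  | succ d ih =>
    set s : ℤ → ℝ := fun z => ∑' j, upLaw w (d + 1) z j with hs
    have hrec : ∀ z, 1 - s z = upProb w z * (1 - s (z + 1)) := by
      intro z
      have h1 : s z = upLaw w (d + 1) z 0 + ∑' j, upLaw w (d + 1) z (j + 1) :=
        (summable_upLaw hw _ _).tsum_eq_zero_add
      have h2 := (summable_upLaw hw d (z - 1)).tsum_eq_zero_add
      rw [ih] at h2
      simp only [upLaw_succ_zero, upLaw_succ_succ] at h1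
      rw [Summable.tsum_add
        (((summable_nat_add_iff 1).2 (summable_upLaw hw d (z - 1))).mul_left _)
        ((summable_upLaw hw (d + 1) (z + 1)).mul_left _), tsum_mul_left, tsum_mul_left] at h1
      have h3 := downProb_add_upProb hw z
      change s z = _ + (_ + _ * s (z + 1)) at h1
      rw [h1]
      linear_combination downProb w z * h2 - h3
    have hs1 : ∀ z, s z ≤ 1 := fun z =>
      Real.tsum_le_of_sum_range_le (upLaw_nonneg hw _ _) (sum_range_upLaw_le_one hw _ _)
    have hs0 : ∀ z, 0 ≤ s z := fun z => tsum_nonneg (upLaw_nonneg hw _ _)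
    have hpow : ∀ N : ℕ, ∀ z : ℤ, 0 ≤ z → 1 - s z ≤ (1 / 2) ^ N := by
      intro N
      induction N with
      | zero => intro z _; have := hs0 z; simp; linarith
      | succ N ihN =>
        intro z hz
        rw [hrec, pow_succ']
        exact mul_le_mul (upProb_le_half hw hm hz) (ihN _ (by omega))
          (by linarith [hs1 (z + 1)]) (by norm_num)
    have hnn : ∀ z, 0 ≤ z → s z = 1 := by
      intro z hz
      refine le_antisymm (hs1 z) ?_
      have := ge_of_tendsto' (tendsto_pow_atTop_nhds_zero_of_lt_one (r := (1 / 2 : ℝ))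
        (by norm_num) (by norm_num)) (fun N => hpow N z hz)
      linarith
    have hall : ∀ n : ℕ, ∀ z : ℤ, -n ≤ z → s z = 1 := by
      intro n
      induction n with
      | zero => intro z hz; exact hnn z (by simpa using hz)
      | succ n ihn =>
        intro z hz
        have := hrec z
        rw [ihn (z + 1) (by push_cast at hz; omega)] at this
        linarith
    exact hall z.natAbs z (by omega)

lemma hasSum_upLaw (hw : ∀ z, 0 < w z) (hm : Monotone w) (d : ℕ) (z : ℤ) :
    HasSum (upLaw w d z) 1 := by
  have := (summable_upLaw hw d z).hasSum
  rwa [tsum_upLaw hw hm] at this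

end LocalChain

/-- Auxiliary half-line version of `edgeWeight`. -/
def edgeWeightNat (w : ℤ → ℝ) : ℕ → ℝ
  | 0 => 1
  | n + 1 => edgeWeightNat w n * (w (-((n : ℤ) + 1)) / w ((n : ℤ) + 1))

/-- The conductance of the edge `{z, z + 1}` for the (reversible) local chain. -/
def edgeWeight (w : ℤ → ℝ) : ℤ → ℝ
  | Int.ofNat n => edgeWeightNat w n
  | Int.negSucc n => edgeWeightNat w n

/-- The reversible measure of the local chain. -/
def siteWeight (w : ℤ → ℝ) (z : ℤ) : ℝ := edgeWeight w z + edgeWeight w (z - 1)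

section Reversible

variable {w : ℤ → ℝ}

lemma GoodWeight.monotone (h : GoodWeight w) : Monotone w := monotone_int_of_le_succ h.2.1

lemma edgeWeightNat_pos (hw : ∀ z, 0 < w z) (n : ℕ) : 0 < edgeWeightNat w n := by
  induction n with
  | zero => simp [edgeWeightNat]
  | succ n ih => exact mul_pos ih (div_pos (hw _) (hw _))

lemma edgeWeight_pos (hw : ∀ z, 0 < w z) (z : ℤ) : 0 < edgeWeight w z := by
  cases z <;> exact edgeWeightNat_pos hw _

lemma edgeWeight_natCast (n : ℕ) : edgeWeight w n = edgeWeightNat w n := rfl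

lemma edgeWeight_neg_add_one (n : ℕ) : edgeWeight w (-((n : ℤ) + 1)) = edgeWeightNat w n := by
  rw [← Int.negSucc_eq]; rfl

lemma edgeWeight_reflect (z : ℤ) : edgeWeight w (-1 - z) = edgeWeight w z := by
  obtain ⟨n, rfl | rfl⟩ : ∃ n : ℕ, z = n ∨ z = -((n : ℤ) + 1) := by
    rcases le_or_gt 0 z with h | h
    · exact ⟨z.toNat, Or.inl (by omega)⟩
    · exact ⟨(-1 - z).toNat, Or.inr (by omega)⟩
  · rw [show -1 - (n : ℤ) = -((n : ℤ) + 1) by ring, edgeWeight_neg_add_one, edgeWeight_natCast]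
  · rw [show -1 - -((n : ℤ) + 1) = n by ring, edgeWeight_neg_add_one, edgeWeight_natCast]

lemma edgeWeight_mul (hw : ∀ z, 0 < w z) (z : ℤ) :
    edgeWeight w z * w z = edgeWeight w (z - 1) * w (-z) := by
  have key : ∀ n : ℕ, edgeWeight w ((n : ℤ) + 1) * w ((n : ℤ) + 1) =
      edgeWeight w n * w (-((n : ℤ) + 1)) := by
    intro n
    have h : edgeWeight w ((n : ℤ) + 1) =
        edgeWeight w n * (w (-((n : ℤ) + 1)) / w ((n : ℤ) + 1)) := by
      have : edgeWeight w ((n + 1 : ℕ) : ℤ) = edgeWeightNat w (n + 1) := rfl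
      rw [← Nat.cast_succ, Nat.succ_eq_add_one, this, edgeWeight_natCast, edgeWeightNat]
      push_cast; rfl
    rw [h]
    have := (hw ((n : ℤ) + 1)).ne'
    field_simp
  rcases lt_trichotomy z 0 with h | h | h
  · obtain ⟨n, rfl⟩ : ∃ n : ℕ, z = -((n : ℤ) + 1) := ⟨(-1 - z).toNat, by omega⟩
    have := key n
    rw [← edgeWeight_reflect (-((n : ℤ) + 1) - 1), ← edgeWeight_reflect (-((n : ℤ) + 1)),
      show -1 - (-((n : ℤ) + 1) - 1) = (n : ℤ) + 1 by ring,
      show -1 - (-((n : ℤ) + 1)) = (n : ℤ) by ring, neg_neg, this]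
  · subst h
    rw [← edgeWeight_reflect 0]; simp
  · obtain ⟨n, rfl⟩ : ∃ n : ℕ, z = (n : ℤ) + 1 := ⟨(z - 1).toNat, by omega⟩
    rw [key n]; simp

lemma siteWeight_pos (hw : ∀ z, 0 < w z) (z : ℤ) : 0 < siteWeight w z :=
  add_pos (edgeWeight_pos hw _) (edgeWeight_pos hw _)

lemma upProb_mul_siteWeight (hw : ∀ z, 0 < w z) (z : ℤ) :
    upProb w z * siteWeight w z = edgeWeight w z := by
  have h := edgeWeight_mul hw z
  have := (add_pos (hw z) (hw (-z))).ne'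
  unfold upProb siteWeight
  field_simp
  linear_combination -h

lemma downProb_mul_siteWeight (hw : ∀ z, 0 < w z) (z : ℤ) :
    downProb w z * siteWeight w z = edgeWeight w (z - 1) := by
  have h := upProb_mul_siteWeight hw z
  have h2 := downProb_add_upProb hw z
  have h3 : siteWeight w z = edgeWeight w z + edgeWeight w (z - 1) := rfl
  linear_combination h2 * siteWeight w z - h + h3

lemma siteWeight_mul_transProb (hw : ∀ z, 0 < w z) (n : ℕ) (z y : ℤ) :
    siteWeight w z * transProb w n z y = siteWeight w y * transProb w n y z := by
  induction n generalizing z with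
  | zero =>
    simp only [transProb]
    by_cases h : z = y
    · subst h; rfl
    · simp [h, Ne.symm h]
  | succ n ih =>
    rw [transProb, transProb_succ_last n y z]
    have h1 := downProb_mul_siteWeight hw z
    have h2 := upProb_mul_siteWeight hw z
    have h3 := upProb_mul_siteWeight hw (z - 1)
    have h4 := downProb_mul_siteWeight hw (z + 1)
    rw [add_sub_cancel_right] at h4
    have e1 := ih (z - 1)
    have e2 := ih (z + 1)
    linear_combination transProb w n (z - 1) y * h1 + transProb w n (z + 1) y * h2
      - transProb w n (z - 1) y * h3 - transProb w n (z + 1) y * h4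
      + upProb w (z - 1) * e1 + downProb w (z + 1) * e2

lemma exists_ratio_lt_one (h : GoodWeight w) :
    ∃ r : ℝ, 0 < r ∧ r < 1 ∧ ∀ᶠ n : ℕ in atTop, w (-((n : ℤ) + 1)) / w ((n : ℤ) + 1) ≤ r := by
  have hm := h.monotone
  obtain ⟨hw, -, c, hc, hev⟩ := h
  refine ⟨w 0 / (w 0 + c), div_pos (hw 0) (add_pos (hw 0) hc), ?_, ?_⟩
  · rw [div_lt_one (add_pos (hw 0) hc)]; linarith
  · have ht : Tendsto (fun n : ℕ => (n : ℤ) + 1) atTop atTop :=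
      tendsto_atTop_add_const_right _ _ tendsto_natCast_atTop_atTop
    filter_upwards [ht.eventually hev] with n hn
    have h0 := hm (show -((n : ℤ) + 1) ≤ 0 by omega)
    rw [div_le_div_iff₀ (hw _) (add_pos (hw 0) hc)]
    have := hw (-((n : ℤ) + 1))
    have := hw 0
    nlinarith

lemma summable_sq_mul_edgeWeightNat (h : GoodWeight w) :
    Summable fun n : ℕ => ((n : ℝ) + 2) ^ 2 * edgeWeightNat w n := by
  obtain ⟨r, hr0, hr1, hr⟩ := exists_ratio_lt_one h
  have hlim : Tendsto (fun n : ℕ => (((n : ℝ) + 3) / ((n : ℝ) + 2)) ^ 2 * r) atTop (𝓝 r) := by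
    have h1 : Tendsto (fun n : ℕ => ((n : ℝ) + 3) / ((n : ℝ) + 2)) atTop (𝓝 1) := by
      have h2 : Tendsto (fun n : ℕ => 1 + 1 / ((n : ℝ) + 2)) atTop (𝓝 (1 + 0)) := by
        refine tendsto_const_nhds.add (tendsto_const_nhds.div_atTop ?_)
        exact tendsto_atTop_add_const_right _ _ tendsto_natCast_atTop_atTop
      rw [add_zero] at h2
      refine h2.congr fun n => ?_
      field_simp
      ring
    simpa using (h1.pow 2).mul_const r
  obtain ⟨r', hrr', hr'⟩ := exists_between hr1
  refine summable_of_ratio_norm_eventually_le hr' ?_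
  filter_upwards [hr, hlim.eventually (gt_mem_nhds hrr')] with n hn hn'
  have hpos := edgeWeightNat_pos h.1 n
  have hpos1 := edgeWeightNat_pos h.1 (n + 1)
  rw [Real.norm_of_nonneg (by positivity), Real.norm_of_nonneg (by positivity), edgeWeightNat]
  have e : ((n : ℝ) + 3) ^ 2 * r ≤ r' * ((n : ℝ) + 2) ^ 2 := by
    rw [div_pow, div_mul_eq_mul_div, div_lt_iff₀ (by positivity)] at hn'
    exact hn'.le
  have e2 : ((n : ℝ) + 3) ^ 2 * (w (-((n : ℤ) + 1)) / w ((n : ℤ) + 1)) ≤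
      r' * ((n : ℝ) + 2) ^ 2 := le_trans (by gcongr) e
  push_cast
  calc ((n : ℝ) + 1 + 2) ^ 2 * (edgeWeightNat w n * (w (-((n : ℤ) + 1)) / w ((n : ℤ) + 1)))
      = edgeWeightNat w n * (((n : ℝ) + 3) ^ 2 * (w (-((n : ℤ) + 1)) / w ((n : ℤ) + 1))) := by
        ring
    _ ≤ edgeWeightNat w n * (r' * ((n : ℝ) + 2) ^ 2) := by gcongr
    _ = _ := by ring

lemma summable_sq_mul_edgeWeight (h : GoodWeight w) :
    Summable fun z : ℤ => (|(z : ℝ)| + 1) ^ 2 * edgeWeight w z := by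
  refine Summable.of_nat_of_neg_add_one ?_ ?_
  · refine Summable.of_nonneg_of_le (fun n => ?_) (fun n => ?_) (summable_sq_mul_edgeWeightNat h)
    · exact mul_nonneg (sq_nonneg _) (edgeWeight_pos h.1 _).le
    · rw [edgeWeight_natCast]
      refine mul_le_mul_of_nonneg_right ?_ (edgeWeightNat_pos h.1 _).le
      push_cast
      rw [abs_of_nonneg (by positivity)]
      gcongr
      norm_num
  · refine Summable.of_nonneg_of_le (fun n => ?_) (fun n => ?_) (summable_sq_mul_edgeWeightNat h)
    · exact mul_nonneg (sq_nonneg _) (edgeWeight_pos h.1 _).le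
    · rw [edgeWeight_neg_add_one]
      refine mul_le_mul_of_nonneg_right ?_ (edgeWeightNat_pos h.1 _).le
      push_cast
      rw [show -((n : ℝ) + 1) = -((n : ℝ) + 1) from rfl, abs_neg, abs_of_nonneg (by positivity)]
      apply le_of_eq; ring

lemma summable_edgeWeight (h : GoodWeight w) : Summable (edgeWeight w) := by
  refine Summable.of_nonneg_of_le (fun n => (edgeWeight_pos h.1 _).le) (fun z => ?_)
    (summable_sq_mul_edgeWeight h)
  have := abs_nonneg (z : ℝ)
  exact le_mul_of_one_le_left (edgeWeight_pos h.1 _).le (by nlinarith)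

lemma summable_siteWeight (h : GoodWeight w) : Summable (siteWeight w) :=
  (summable_edgeWeight h).add ((Equiv.subRight (1 : ℤ)).summable_iff.2 (summable_edgeWeight h))

/-- The Dirichlet form of the return probabilities is summable in time, so that their discrete
gradient vanishes in the limit. -/
lemma tendsto_transProb_gradient (h : GoodWeight w) (y : ℤ) :
    Tendsto (fun n => transProb w n (y + 1) 0 - transProb w n (y - 1) 0) atTop (𝓝 0) := by
  have hw := h.1
  set E : ℕ → ℝ := fun n => ∑' z, siteWeight w z * transProb w n z 0 ^ 2 with hE
  have hsq : ∀ n z, transProb w n z 0 ^ 2 ≤ 1 := fun n z =>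
    pow_le_one₀ (transProb_nonneg hw _ _ _) (transProb_le_one hw _ _ _)
  have hsum : ∀ n, Summable fun z => siteWeight w z * transProb w n z 0 ^ 2 := fun n =>
    Summable.of_nonneg_of_le (fun z => mul_nonneg (siteWeight_pos hw z).le (sq_nonneg _))
      (fun z => mul_le_of_le_one_right (siteWeight_pos hw z).le (hsq n z)) (summable_siteWeight h)
  have hE0 : ∀ n, 0 ≤ E n := fun n =>
    tsum_nonneg fun z => mul_nonneg (siteWeight_pos hw z).le (sq_nonneg _)
  have hs1 : ∀ n, Summable fun z => edgeWeight w z * transProb w n z 0 ^ 2 := fun n =>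
    Summable.of_nonneg_of_le (fun z => mul_nonneg (edgeWeight_pos hw z).le (sq_nonneg _))
      (fun z => mul_le_of_le_one_right (edgeWeight_pos hw z).le (hsq n z)) (summable_edgeWeight h)
  have hs2 : ∀ n, Summable fun z => edgeWeight w (z - 1) * transProb w n z 0 ^ 2 := fun n => by
    refine ((hsum n).sub (hs1 n)).congr fun z => ?_
    simp only [siteWeight]; ring
  have hs3 : ∀ n, Summable fun z => edgeWeight w (z - 1) * transProb w n (z - 1) 0 ^ 2 :=
    fun n => (Equiv.subRight (1 : ℤ)).summable_iff.2 (hs1 n)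
  have hs4 : ∀ n, Summable fun z => edgeWeight w z * transProb w n (z + 1) 0 ^ 2 := fun n => by
    have := (Equiv.addRight (1 : ℤ)).summable_iff.2 (hs2 n)
    refine this.congr fun z => ?_
    simp
  set D : ℕ → ℤ → ℝ := fun n z => siteWeight w z * (upProb w z * downProb w z) *
    (transProb w n (z + 1) 0 - transProb w n (z - 1) 0) ^ 2 with hD
  have hD0 : ∀ n z, 0 ≤ D n z := fun n z => by
    have := siteWeight_pos hw z
    have := upProb_pos hw z
    have := downProb_pos hw z
    positivity
  have hident : ∀ n z, D n z = edgeWeight w (z - 1) * transProb w n (z - 1) 0 ^ 2 +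
      edgeWeight w z * transProb w n (z + 1) 0 ^ 2 -
      siteWeight w z * transProb w (n + 1) z 0 ^ 2 := by
    intro n z
    have h1 := downProb_mul_siteWeight hw z
    have h2 := upProb_mul_siteWeight hw z
    have h3 := downProb_add_upProb hw z
    rw [← h1, ← h2, transProb]
    have h4 : downProb w z = 1 - upProb w z := by linarith
    simp only [hD, h4]
    ring
  have hDs : ∀ n, Summable (D n) := fun n =>
    (((hs3 n).add (hs4 n)).sub (hsum (n + 1))).congr fun z => (hident n z).symm
  have hDE : ∀ n, ∑' z, D n z = E n - E (n + 1) := by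
    intro n
    have t3 : ∑' z, edgeWeight w (z - 1) * transProb w n (z - 1) 0 ^ 2 =
        ∑' z, edgeWeight w z * transProb w n z 0 ^ 2 :=
      (Equiv.subRight (1 : ℤ)).tsum_eq fun z => edgeWeight w z * transProb w n z 0 ^ 2
    have t4 : ∑' z, edgeWeight w z * transProb w n (z + 1) 0 ^ 2 =
        ∑' z, edgeWeight w (z - 1) * transProb w n z 0 ^ 2 := by
      rw [← (Equiv.addRight (1 : ℤ)).tsum_eq fun z => edgeWeight w (z - 1) * transProb w n z 0 ^ 2]
      simp
    simp only [hident]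
    rw [((hs3 n).add (hs4 n)).tsum_sub (hsum (n + 1)), (hs3 n).tsum_add (hs4 n), t3, t4,
      ← (hs1 n).tsum_add (hs2 n)]
    simp only [hE, siteWeight, add_mul]
  have hsumD : Summable fun n => D n y := by
    refine summable_of_sum_range_le (c := E 0) (fun n => hD0 n y) fun N => ?_
    have : ∀ N, ∑ n ∈ Finset.range N, D n y ≤ E 0 - E N := by
      intro N
      induction N with
      | zero => simp
      | succ N ih =>
        rw [Finset.sum_range_succ]
        have := (hDs N).le_tsum y fun z _ => hD0 N z
        rw [hDE] at this
        linarith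
    linarith [this N, hE0 N]
  have hpos : 0 < siteWeight w y * (upProb w y * downProb w y) :=
    mul_pos (siteWeight_pos hw y) (mul_pos (upProb_pos hw y) (downProb_pos hw y))
  have h1 := (hsumD.tendsto_atTop_zero).const_mul (siteWeight w y * (upProb w y * downProb w y))⁻¹
  rw [mul_zero] at h1
  have h2 : Tendsto (fun n => (transProb w n (y + 1) 0 - transProb w n (y - 1) 0) ^ 2) atTop
      (𝓝 0) := by
    refine h1.congr fun n => ?_
    simp only [hD]
    rw [inv_mul_cancel_left₀ hpos.ne']
  have h3 := (Real.continuous_sqrt.tendsto 0).comp h2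
  rw [Real.sqrt_zero] at h3
  refine (tendsto_zero_iff_abs_tendsto_zero _).2 (h3.congr fun n => ?_)
  simp [Real.sqrt_sq_eq_abs]

end Reversible

section UpLawAsymptotics

variable {w : ℤ → ℝ}

lemma upLaw_succ_origin (hw : ∀ z, 0 < w z) (d j : ℕ) :
    upLaw w (d + 1) 0 j = edgeWeight w ((j : ℤ) - d - 1) / siteWeight w 0 *
      transProb w (d + j) ((j : ℤ) - d) 0 := by
  have h1 := siteWeight_mul_transProb hw (d + j) 0 ((j : ℤ) - d)
  have h2 := downProb_mul_siteWeight hw ((j : ℤ) - d)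
  have h3 := (siteWeight_pos hw 0).ne'
  rw [← h2, upLaw, zero_add]
  field_simp
  linear_combination downProb w ((j : ℤ) - d) * h1

lemma upLaw_zero_right_pos (hw : ∀ z, 0 < w z) (d : ℕ) (z : ℤ) : 0 < upLaw w d z 0 := by
  induction d generalizing z with
  | zero => simp [upLaw]
  | succ d ih => rw [upLaw_succ_zero]; exact mul_pos (downProb_pos hw _) (ih _)

/-- Law of the local chain at its `d`-th down step, started from `0`, as a function on `ℤ`. -/
def stateLaw (w : ℤ → ℝ) (d : ℕ) (z : ℤ) : ℝ :=
  if 0 ≤ z + d then upLaw w d 0 (z + d).toNat else 0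

lemma stateLaw_nonneg (hw : ∀ z, 0 < w z) (d : ℕ) (z : ℤ) : 0 ≤ stateLaw w d z := by
  unfold stateLaw
  split_ifs
  exacts [upLaw_nonneg hw _ _ _, le_rfl]

lemma hasSum_mul_stateLaw_iff (d : ℕ) (f : ℤ → ℝ) (a : ℝ) :
    HasSum (fun j : ℕ => upLaw w d 0 j * f ((j : ℤ) - d)) a ↔
      HasSum (fun z : ℤ => stateLaw w d z * f z) a := by
  have hi : Function.Injective fun j : ℕ => (j : ℤ) - d := fun a b h => by
    simp only at h; omega
  rw [← hi.hasSum_iff]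
  · refine iff_of_eq (congrArg (HasSum · a) (funext fun j => ?_))
    simp [stateLaw]
  · intro z hz
    rw [stateLaw, if_neg, zero_mul]
    intro h
    exact hz ⟨(z + d).toNat, by simp only; omega⟩

lemma stateLaw_succ (hw : ∀ z, 0 < w z) {d : ℕ} {z : ℤ} (h : 0 ≤ z + d + 1) :
    stateLaw w (d + 1) z = edgeWeight w z / siteWeight w 0 *
      transProb w (2 * d + 1 + z).toNat (z + 1) 0 := by
  rw [stateLaw, if_pos (by push_cast; omega), upLaw_succ_origin hw]
  have e1 : (((z + ((d + 1 : ℕ) : ℤ)).toNat : ℕ) : ℤ) = z + d + 1 := by omega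
  rw [e1]
  congr 2 <;> (congr 1; omega)

lemma stateLaw_le (hw : ∀ z, 0 < w z) (d : ℕ) (z : ℤ) :
    stateLaw w (d + 1) z ≤ edgeWeight w z / siteWeight w 0 := by
  have h0 := (div_pos (edgeWeight_pos hw z) (siteWeight_pos hw 0)).le
  by_cases h : 0 ≤ z + d + 1
  · rw [stateLaw_succ hw h]
    exact mul_le_of_le_one_right h0 (transProb_le_one hw _ _ _)
  · rw [stateLaw, if_neg (by push_cast; omega)]
    exact h0

/-- The second moments of the net displacement at the `d`-th down step are bounded. -/
lemma exists_upLaw_sq_le (h : GoodWeight w) :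
    ∃ C : ℝ, ∀ d, Summable (fun j : ℕ => upLaw w d 0 j * ((j : ℝ) - d) ^ 2) ∧
      ∑' j : ℕ, upLaw w d 0 j * ((j : ℝ) - d) ^ 2 ≤ C := by
  have hw := h.1
  have hsum : Summable fun z : ℤ => (|(z : ℝ)| + 1) ^ 2 * edgeWeight w z / siteWeight w 0 :=
    (summable_sq_mul_edgeWeight h).div_const _
  refine ⟨∑' z : ℤ, (|(z : ℝ)| + 1) ^ 2 * edgeWeight w z / siteWeight w 0, fun d => ?_⟩
  have hC : 0 ≤ ∑' z : ℤ, (|(z : ℝ)| + 1) ^ 2 * edgeWeight w z / siteWeight w 0 :=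
    tsum_nonneg fun z => div_nonneg (mul_nonneg (sq_nonneg _) (edgeWeight_pos hw _).le)
      (siteWeight_pos hw 0).le
  cases d with
  | zero =>
    have : (fun j : ℕ => upLaw w 0 0 j * ((j : ℝ) - (0 : ℕ)) ^ 2) = fun _ => 0 := by
      funext j
      by_cases hj : j = 0 <;> simp [upLaw, hj]
    rw [this]
    exact ⟨summable_zero, by simpa using hC⟩
  | succ d =>
    have hle : ∀ z : ℤ, stateLaw w (d + 1) z * (z : ℝ) ^ 2 ≤
        (|(z : ℝ)| + 1) ^ 2 * edgeWeight w z / siteWeight w 0 := by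
      intro z
      have h1 := stateLaw_le hw d z
      have h2 : (z : ℝ) ^ 2 ≤ (|(z : ℝ)| + 1) ^ 2 := by
        rw [← sq_abs]
        have := abs_nonneg (z : ℝ)
        gcongr; linarith
      calc stateLaw w (d + 1) z * (z : ℝ) ^ 2
          ≤ edgeWeight w z / siteWeight w 0 * (|(z : ℝ)| + 1) ^ 2 :=
            mul_le_mul h1 h2 (sq_nonneg _) (div_pos (edgeWeight_pos hw z) (siteWeight_pos hw 0)).le
        _ = _ := by ring
    have hs : Summable fun z : ℤ => stateLaw w (d + 1) z * (z : ℝ) ^ 2 :=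
      Summable.of_nonneg_of_le (fun z => mul_nonneg (stateLaw_nonneg hw _ _) (sq_nonneg _)) hle hsum
    have h3 := (hasSum_mul_stateLaw_iff (d + 1) (fun z => (z : ℝ) ^ 2) _).2 hs.hasSum
    have h4 : (fun j : ℕ => upLaw w (d + 1) 0 j * ((j : ℝ) - (d + 1 : ℕ)) ^ 2) =
        fun j : ℕ => upLaw w (d + 1) 0 j * (((j : ℤ) - ((d + 1 : ℕ) : ℤ) : ℤ) : ℝ) ^ 2 := by
      funext j; push_cast; rfl
    rw [h4]
    exact ⟨h3.summable, h3.tsum_eq.trans_le (hs.tsum_le_tsum hle hsum)⟩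

lemma tendsto_transProb_shift (h : GoodWeight w) (z : ℤ) :
    Tendsto (fun d : ℕ => transProb w (2 * d + 1 + z).toNat (z + 1) 0 -
      transProb w (2 * d + 1 + (z - 1)).toNat (z - 1 + 1) 0) atTop (𝓝 0) := by
  have ht : Tendsto (fun d : ℕ => (2 * (d : ℤ) + z).toNat) atTop atTop := by
    refine tendsto_atTop.2 fun b => ?_
    filter_upwards [eventually_ge_atTop (b + z.natAbs)] with d hd
    omega
  have h1 := ((tendsto_transProb_gradient h (z + 1)).comp ht).const_mul (upProb w (z + 1))
  rw [mul_zero] at h1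
  refine h1.congr' ?_
  filter_upwards [eventually_ge_atTop z.natAbs] with d hd
  have e1 : (2 * (d : ℤ) + 1 + z).toNat = (2 * (d : ℤ) + z).toNat + 1 := by omega
  have e2 : (2 * (d : ℤ) + 1 + (z - 1)).toNat = (2 * (d : ℤ) + z).toNat := by omega
  have h3 := downProb_add_upProb h.1 (z + 1)
  have h4 : downProb w (z + 1) = 1 - upProb w (z + 1) := by linarith
  rw [e1, e2, transProb, Function.comp, h4]
  simp only [add_sub_cancel_right, sub_add_cancel]
  ring

lemma tendsto_transProb_shift_zero (h : GoodWeight w) (z : ℤ) :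
    Tendsto (fun d : ℕ => transProb w (2 * d + 1 + z).toNat (z + 1) 0 -
      transProb w (2 * (d : ℤ) + 1 + 0).toNat (0 + 1) 0) atTop (𝓝 0) := by
  induction z using Int.induction_on with
  | zero => simp
  | succ n ih =>
    have := (tendsto_transProb_shift h ((n : ℤ) + 1)).add ih
    simpa using this
  | pred n ih =>
    have := ih.sub (tendsto_transProb_shift h (-(n : ℤ)))
    rw [sub_zero] at this
    refine this.congr fun d => ?_
    ring

lemma tendsto_stateLaw_reflect (h : GoodWeight w) (z : ℤ) :
    Tendsto (fun d : ℕ => stateLaw w (d + 1) z - stateLaw w (d + 1) (-1 - z)) atTop (𝓝 0) := by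
  have h1 := ((tendsto_transProb_shift_zero h z).sub
    (tendsto_transProb_shift_zero h (-1 - z))).const_mul (edgeWeight w z / siteWeight w 0)
  rw [sub_zero, mul_zero] at h1
  refine h1.congr' ?_
  filter_upwards [eventually_ge_atTop (z.natAbs + 1)] with d hd
  rw [stateLaw_succ h.1 (by omega), stateLaw_succ h.1 (by omega), edgeWeight_reflect]
  ring

lemma norm_stateLaw_mul_le (hw : ∀ z, 0 < w z) (d : ℕ) {z : ℤ} {c : ℝ}
    (hc : |c| ≤ (|(z : ℝ)| + 1) ^ 2) :
    ‖stateLaw w (d + 1) z * c‖ ≤ (|(z : ℝ)| + 1) ^ 2 * edgeWeight w z / siteWeight w 0 := by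
  rw [norm_mul, Real.norm_eq_abs, Real.norm_eq_abs, abs_of_nonneg (stateLaw_nonneg hw _ _)]
  calc stateLaw w (d + 1) z * |c|
      ≤ edgeWeight w z / siteWeight w 0 * (|(z : ℝ)| + 1) ^ 2 :=
        mul_le_mul (stateLaw_le hw d z) hc (abs_nonneg _)
          (div_pos (edgeWeight_pos hw z) (siteWeight_pos hw 0)).le
    _ = _ := by ring

lemma abs_add_half_le (z : ℤ) : |(z : ℝ) + 1 / 2| ≤ (|(z : ℝ)| + 1) ^ 2 := by
  have h1 := abs_add_le (z : ℝ) (1 / 2)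
  have h2 := abs_nonneg (z : ℝ)
  rw [abs_of_pos (by norm_num : (0 : ℝ) < 1 / 2)] at h1
  nlinarith

lemma summable_stateLaw_mul_add_half (h : GoodWeight w) (d : ℕ) :
    Summable fun z : ℤ => stateLaw w (d + 1) z * ((z : ℝ) + 1 / 2) :=
  Summable.of_norm_bounded ((summable_sq_mul_edgeWeight h).div_const _) fun z =>
    norm_stateLaw_mul_le h.1 d (abs_add_half_le z)

lemma tsum_upLaw_mean_eq (h : GoodWeight w) (d : ℕ) :
    ∑' j : ℕ, upLaw w (d + 1) 0 j * ((j : ℝ) - (d + 1 : ℕ)) =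
      1 / 2 * (∑' z : ℤ, (stateLaw w (d + 1) z - stateLaw w (d + 1) (-1 - z)) * ((z : ℝ) + 1 / 2))
        - 1 / 2 := by
  have h1 : HasSum (fun z : ℤ => stateLaw w (d + 1) z * 1) 1 := by
    refine (hasSum_mul_stateLaw_iff (d + 1) (fun _ => 1) 1).1 ?_
    simpa using hasSum_upLaw h.1 h.monotone (d + 1) 0
  have h2 := (summable_stateLaw_mul_add_half h d).hasSum
  set S := ∑' z : ℤ, stateLaw w (d + 1) z * ((z : ℝ) + 1 / 2)
  have h3 : HasSum (fun z : ℤ => stateLaw w (d + 1) z * (z : ℝ)) (S - 1 / 2 * 1) := by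
    have h0 := h2.sub (h1.mul_left (1 / 2))
    rwa [show (fun z : ℤ => stateLaw w (d + 1) z * ((z : ℝ) + 1 / 2) -
      1 / 2 * (stateLaw w (d + 1) z * 1)) = fun z : ℤ => stateLaw w (d + 1) z * (z : ℝ)
      from funext fun z => by ring] at h0
  have h4 := (hasSum_mul_stateLaw_iff (d + 1) (fun z => (z : ℝ)) _).2 h3
  have h5 : HasSum (fun z : ℤ => stateLaw w (d + 1) (-1 - z) * (((-1 - z : ℤ) : ℝ) + 1 / 2)) S :=
    ((Equiv.subLeft (-1 : ℤ)).hasSum_iff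
      (f := fun z : ℤ => stateLaw w (d + 1) z * ((z : ℝ) + 1 / 2))).2 h2
  have h6 : HasSum (fun z : ℤ =>
      (stateLaw w (d + 1) z - stateLaw w (d + 1) (-1 - z)) * ((z : ℝ) + 1 / 2)) (S + S) := by
    convert (h2.add h5) using 1
    funext z
    push_cast
    ring
  have h7 : HasSum (fun j : ℕ => upLaw w (d + 1) 0 j * ((j : ℝ) - (d + 1 : ℕ)))
      (S - 1 / 2 * 1) := by
    convert h4 using 1
    funext j
    push_cast
    ring
  rw [h6.tsum_eq, h7.tsum_eq]
  ring

/-- The mean net displacement at the `d`-th down step converges to `-1/2`. -/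
lemma tendsto_upLaw_mean (h : GoodWeight w) :
    Tendsto (fun d : ℕ => ∑' j : ℕ, upLaw w d 0 j * ((j : ℝ) - d)) atTop (𝓝 (-(1 / 2))) := by
  rw [← tendsto_add_atTop_iff_nat 1]
  have hsum : Summable fun z : ℤ => (|(z : ℝ)| + 1) ^ 2 * edgeWeight w z / siteWeight w 0 :=
    (summable_sq_mul_edgeWeight h).div_const _
  have hsum' : Summable fun z : ℤ =>
      (|((-1 - z : ℤ) : ℝ)| + 1) ^ 2 * edgeWeight w (-1 - z) / siteWeight w 0 :=
    ((Equiv.subLeft (-1 : ℤ)).summable_iff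
      (f := fun z : ℤ => (|(z : ℝ)| + 1) ^ 2 * edgeWeight w z / siteWeight w 0)).2 hsum
  have hlim : Tendsto (fun d : ℕ => ∑' z : ℤ,
      (stateLaw w (d + 1) z - stateLaw w (d + 1) (-1 - z)) * ((z : ℝ) + 1 / 2)) atTop
      (𝓝 (∑' _ : ℤ, (0 : ℝ))) := by
    refine tendsto_tsum_of_dominated_convergence (hsum.add hsum') (fun z => ?_)
      (Eventually.of_forall fun d z => ?_)
    · have := (tendsto_stateLaw_reflect h z).mul_const ((z : ℝ) + 1 / 2)
      rwa [zero_mul] at this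
    · rw [sub_mul]
      refine (norm_sub_le _ _).trans (add_le_add (norm_stateLaw_mul_le h.1 d (abs_add_half_le z))
        (norm_stateLaw_mul_le h.1 d ?_))
      have := abs_add_half_le (-1 - z)
      rwa [show (((-1 - z : ℤ) : ℝ) + 1 / 2) = -((z : ℝ) + 1 / 2) by push_cast; ring, abs_neg]
        at this
  have h3 := (hlim.const_mul (1 / 2)).sub_const (1 / 2)
  rw [tsum_zero, mul_zero, zero_sub] at h3
  exact h3.congr fun d => (tsum_upLaw_mean_eq h d).symm

end UpLawAsymptotics

/-- The operator `Φ ↦ ∑ j, K d j Φ j` on nonnegative functions. -/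
def kerOp (K : ℕ → ℕ → ℝ) (Φ : ℕ → ℝ≥0∞) (d : ℕ) : ℝ≥0∞ :=
  ∑' j, ENNReal.ofReal (K d j) * Φ j

/-- A Markov kernel on `ℕ`, absorbed at `0`, with bounded second moments of the increments and
asymptotic mean increment `-1/2`. -/
structure CriticalKernel (K : ℕ → ℕ → ℝ) (C : ℝ) : Prop where
  nonneg : ∀ d j, 0 ≤ K d j
  hasSum_one : ∀ d, HasSum (K d) 1
  summable_sq : ∀ d, Summable fun j : ℕ => K d j * ((j : ℝ) - d) ^ 2
  tsum_sq_le : ∀ d, ∑' j : ℕ, K d j * ((j : ℝ) - d) ^ 2 ≤ C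
  tendsto_mean :
    Tendsto (fun d : ℕ => ∑' j : ℕ, K d j * ((j : ℝ) - d)) atTop (𝓝 (-(1 / 2)))
  pos_zero : ∀ d, 0 < K d 0
  absorbing : ∀ j, K 0 j = if j = 0 then 1 else 0

lemma exists_criticalKernel_upLaw {w : ℤ → ℝ} (h : GoodWeight w) :
    ∃ C, CriticalKernel (fun d j => upLaw w d 0 j) C := by
  obtain ⟨C, hC⟩ := exists_upLaw_sq_le h
  exact ⟨C, fun d j => upLaw_nonneg h.1 d 0 j, fun d => hasSum_upLaw h.1 h.monotone d 0,
    fun d => (hC d).1, fun d => (hC d).2, tendsto_upLaw_mean h,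
    fun d => upLaw_zero_right_pos h.1 d 0, fun j => rfl⟩

section KerOp

variable {K : ℕ → ℕ → ℝ} {C : ℝ}

lemma kerOp_mono {Φ Ψ : ℕ → ℝ≥0∞} (h : Φ ≤ Ψ) : kerOp K Φ ≤ kerOp K Ψ := fun d =>
  ENNReal.tsum_le_tsum fun j => by gcongr; exact h j

lemma iterate_kerOp_mono {Φ Ψ : ℕ → ℝ≥0∞} (h : Φ ≤ Ψ) (k : ℕ) :
    (kerOp K)^[k] Φ ≤ (kerOp K)^[k] Ψ :=
  Monotone.iterate (fun _ _ => kerOp_mono) k h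

lemma kerOp_add (Φ Ψ : ℕ → ℝ≥0∞) : kerOp K (Φ + Ψ) = kerOp K Φ + kerOp K Ψ := by
  funext d
  simp only [kerOp, Pi.add_apply, mul_add, ENNReal.tsum_add]

lemma kerOp_const_mul (c : ℝ≥0∞) (Φ : ℕ → ℝ≥0∞) :
    kerOp K (fun u => c * Φ u) = fun u => c * kerOp K Φ u := by
  funext d
  simp only [kerOp, ← ENNReal.tsum_mul_left]
  exact tsum_congr fun j => by ring

lemma iterate_kerOp_add (Φ Ψ : ℕ → ℝ≥0∞) (k : ℕ) :
    (kerOp K)^[k] (Φ + Ψ) = (kerOp K)^[k] Φ + (kerOp K)^[k] Ψ := by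
  induction k with
  | zero => rfl
  | succ k ih => simp only [Function.iterate_succ_apply', ih, kerOp_add]

lemma iterate_kerOp_const_mul (c : ℝ≥0∞) (Φ : ℕ → ℝ≥0∞) (k : ℕ) :
    (kerOp K)^[k] (fun u => c * Φ u) = fun u => c * (kerOp K)^[k] Φ u := by
  induction k with
  | zero => rfl
  | succ k ih => simp only [Function.iterate_succ_apply', ih, kerOp_const_mul]

lemma sum_iterate_kerOp_le {g V : ℕ → ℝ≥0∞} (h : kerOp K V + g ≤ V) (M : ℕ) :
    ∑ k ∈ Finset.range M, (kerOp K)^[k] g ≤ V := by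
  induction M with
  | zero => intro u; simp
  | succ M ih =>
    have hs : ∀ M, kerOp K (∑ k ∈ Finset.range M, (kerOp K)^[k] g) =
        ∑ k ∈ Finset.range M, (kerOp K)^[k + 1] g := by
      intro M
      induction M with
      | zero => funext d; simp [kerOp]
      | succ M ih => rw [Finset.sum_range_succ, kerOp_add, ih, Finset.sum_range_succ,
          Function.iterate_succ_apply' _ M]
    rw [Finset.sum_range_succ', ← hs]
    exact (add_le_add (kerOp_mono ih) le_rfl).trans h

namespace CriticalKernel

lemma kerOp_ofReal (hK : CriticalKernel K C) {F : ℕ → ℝ} (hF : ∀ j, 0 ≤ F j) {d : ℕ} {a : ℝ}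
    (h : HasSum (fun j => K d j * F j) a) :
    kerOp K (fun j => ENNReal.ofReal (F j)) d = ENNReal.ofReal a := by
  rw [← h.tsum_eq, ENNReal.ofReal_tsum_of_nonneg (fun j => mul_nonneg (hK.nonneg d j) (hF j))
    h.summable]
  exact tsum_congr fun j => (ENNReal.ofReal_mul (hK.nonneg d j)).symm

lemma kerOp_const (hK : CriticalKernel K C) (c : ℝ≥0∞) : kerOp K (fun _ => c) = fun _ => c := by
  funext d
  have h1 : ∑' j, ENNReal.ofReal (K d j) = 1 := by
    rw [← ENNReal.ofReal_tsum_of_nonneg (hK.nonneg d) (hK.hasSum_one d).summable,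
      (hK.hasSum_one d).tsum_eq, ENNReal.ofReal_one]
  rw [kerOp, ENNReal.tsum_mul_right, h1, one_mul]

lemma iterate_kerOp_const (hK : CriticalKernel K C) (c : ℝ≥0∞) (k : ℕ) :
    (kerOp K)^[k] (fun _ => c) = fun _ => c := by
  induction k with
  | zero => rfl
  | succ k ih => rw [Function.iterate_succ_apply', ih, hK.kerOp_const]

lemma C_nonneg (hK : CriticalKernel K C) : 0 ≤ C :=
  (tsum_nonneg fun j => mul_nonneg (hK.nonneg 0 j) (sq_nonneg _)).trans (hK.tsum_sq_le 0)

lemma hasSum_sq (hK : CriticalKernel K C) (d : ℕ) :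
    ∃ s ≤ C, HasSum (fun j : ℕ => K d j * ((j : ℝ) - d) ^ 2) s :=
  ⟨_, hK.tsum_sq_le d, (hK.summable_sq d).hasSum⟩

lemma norm_mean_term_le (hK : CriticalKernel K C) (d j : ℕ) :
    ‖K d j * ((j : ℝ) - d)‖ ≤ K d j + K d j * ((j : ℝ) - d) ^ 2 := by
  rw [norm_mul, Real.norm_eq_abs, Real.norm_eq_abs, abs_of_nonneg (hK.nonneg d j), ← sq_abs]
  have := hK.nonneg d j
  nlinarith [sq_nonneg (|(j : ℝ) - d| - 1), abs_nonneg ((j : ℝ) - d)]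

lemma hasSum_mean (hK : CriticalKernel K C) (d : ℕ) : HasSum (fun j : ℕ => K d j * ((j : ℝ) - d))
    (∑' j : ℕ, K d j * ((j : ℝ) - d)) :=
  (Summable.of_norm_bounded ((hK.hasSum_one d).summable.add (hK.summable_sq d))
    (hK.norm_mean_term_le d)).hasSum

lemma abs_mean_le (hK : CriticalKernel K C) (d : ℕ) :
    |∑' j : ℕ, K d j * ((j : ℝ) - d)| ≤ 1 + C := by
  obtain ⟨s, hs, h⟩ := hK.hasSum_sq d
  have := tsum_of_norm_bounded ((hK.hasSum_one d).add h) (hK.norm_mean_term_le d)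
  rw [Real.norm_eq_abs] at this
  linarith

lemma hasSum_pos_indicator (hK : CriticalKernel K C) (d : ℕ) :
    HasSum (fun j : ℕ => K d j * (if j = 0 then 0 else 1)) (1 - K d 0) := by
  have h1 : HasSum (fun j : ℕ => if j = 0 then K d 0 else 0) (K d 0) := hasSum_ite_eq 0 (K d 0)
  have h2 : (fun j : ℕ => K d j * (if j = 0 then (0 : ℝ) else 1)) =
      fun j => K d j - if j = 0 then K d 0 else 0 := by
    funext j
    by_cases hj : j = 0 <;> simp [hj]
  rw [h2]
  exact (hK.hasSum_one d).sub h1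

lemma exists_pos_le_zero (hK : CriticalKernel K C) (d₀ : ℕ) : ∃ α > 0, ∀ d < d₀, α ≤ K d 0 := by
  induction d₀ with
  | zero => exact ⟨1, one_pos, fun d hd => absurd hd (by omega)⟩
  | succ n ih =>
    obtain ⟨α, hα, h⟩ := ih
    refine ⟨min α (K n 0), lt_min hα (hK.pos_zero n), fun d hd => ?_⟩
    rcases Nat.lt_succ_iff_lt_or_eq.1 hd with h1 | rfl
    · exact (min_le_left _ _).trans (h d h1)
    · exact min_le_right _ _

/-- Upper bound for the expected total progeny of the absorbed chain. -/
lemma sum_iterate_id_le (hK : CriticalKernel K C) {ε : ℝ} (hε : 0 < ε) :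
    ∃ r₀ : ℕ, ∀ r ≥ r₀, ∀ M, ∑ k ∈ Finset.range M, (kerOp K)^[k] (fun u => (u : ℝ≥0∞)) r ≤
      ENNReal.ofReal ((1 + ε) * r ^ 2) := by
  have hC := hK.C_nonneg
  set m : ℕ → ℝ := fun d => ∑' j : ℕ, K d j * ((j : ℝ) - d) with hm
  -- choose the slack `δ` with `1 / (1 - 2 δ) < 1 + ε`
  obtain ⟨δ, hδ0, hδ4, hδ⟩ : ∃ δ > 0, δ ≤ 1 / 4 ∧ 1 + ε / 2 ≤ (1 - 2 * δ) * (1 + ε) := by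
    refine ⟨min (1 / 4) (ε / (4 * (1 + ε))), by positivity, min_le_left _ _, ?_⟩
    have h1 : min (1 / 4) (ε / (4 * (1 + ε))) * (1 + ε) ≤ ε / 4 := by
      calc _ ≤ ε / (4 * (1 + ε)) * (1 + ε) := by gcongr; exact min_le_right _ _
        _ = ε / 4 := by field_simp
    linarith
  obtain ⟨d₀, hd₀⟩ : ∃ d₀, ∀ d ≥ d₀, m d ≤ -(1 / 2) + δ := by
    refine eventually_atTop.1 ((hK.tendsto_mean.eventually (eventually_le_nhds ?_)))
    linarith
  obtain ⟨α, hα, hαK⟩ := hK.exists_pos_le_zero d₀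
  set b : ℝ := (2 * d₀ * (1 + C) + C + 4 * C * (1 + C) + d₀) / α with hb
  have hb0 : 0 ≤ b := by positivity
  set V : ℕ → ℝ := fun u => (u : ℝ) ^ 2 + 4 * C * u + b * (if u = 0 then 0 else 1) with hV
  have hV0 : ∀ u, 0 ≤ V u := fun u => by
    have : (0 : ℝ) ≤ if u = 0 then 0 else 1 := by split_ifs <;> norm_num
    positivity
  have hPV : kerOp K (fun u => ENNReal.ofReal (V u)) +
      (fun u : ℕ => ENNReal.ofReal (1 - 2 * δ) * (u : ℝ≥0∞)) ≤ fun u => ENNReal.ofReal (V u) := by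
    intro d
    obtain ⟨s, hs, hsum⟩ := hK.hasSum_sq d
    have h1 : HasSum (fun j => K d j * V j)
        (s + (2 * d + 4 * C) * m d + (d ^ 2 + 4 * C * d) * 1 + b * (1 - K d 0)) := by
      convert ((hsum.add ((hK.hasSum_mean d).mul_left (2 * d + 4 * C))).add
        ((hK.hasSum_one d).mul_left (d ^ 2 + 4 * C * d))).add
        ((hK.hasSum_pos_indicator d).mul_left b) using 1
      funext j
      simp only [hV]
      ring
    rw [Pi.add_apply, hK.kerOp_ofReal hV0 h1, ← ENNReal.ofReal_natCast,
      ← ENNReal.ofReal_mul (by linarith), ← ENNReal.ofReal_add _ (by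
        have : (0 : ℝ) ≤ d := Nat.cast_nonneg d
        exact mul_nonneg (by linarith) this)]
    swap
    · exact h1.nonneg fun j => mul_nonneg (hK.nonneg d j) (hV0 j)
    refine ENNReal.ofReal_le_ofReal ?_
    have hmd := abs_le.1 (hK.abs_mean_le d)
    change -(1 + C) ≤ m d ∧ m d ≤ 1 + C at hmd
    rcases Nat.eq_zero_or_pos d with rfl | hd
    · have hK0 := hK.absorbing
      have e1 : s = 0 := by
        refine hsum.unique ?_
        convert hasSum_zero using 1
        funext j
        by_cases hj : j = 0 <;> simp [hK0, hj]
      have e2 : m 0 = 0 := by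
        simp only [hm]
        convert tsum_zero using 1
        refine tsum_congr fun j => ?_
        by_cases hj : j = 0 <;> simp [hK0, hj]
      simp [hV, hK0, e1, e2]
    · have hVd : V d = d ^ 2 + 4 * C * d + b := by simp [hV, hd.ne']
      rw [hVd]
      have hd1 : (1 : ℝ) ≤ d := by exact_mod_cast hd
      by_cases hdd : d₀ ≤ d
      · have h3 := hd₀ d hdd
        have h4 : 0 ≤ b * K d 0 := mul_nonneg hb0 (hK.nonneg _ _)
        have h5 : (2 * d + 4 * C) * m d ≤ (2 * d + 4 * C) * (-(1 / 2) + δ) := by gcongr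
        nlinarith
      · have h3 := hαK d (by omega)
        have h4 : b * α ≤ b * K d 0 := by gcongr
        have h5 : b * α = 2 * d₀ * (1 + C) + C + 4 * C * (1 + C) + d₀ := by
          rw [hb]; field_simp
        have h6 : (2 * d + 4 * C) * m d ≤ (2 * d + 4 * C) * (1 + C) := by gcongr; exact hmd.2
        have h7 : (d : ℝ) ≤ d₀ := by exact_mod_cast (by omega : d ≤ d₀)
        nlinarith
  have hmain := sum_iterate_kerOp_le hPV
  obtain ⟨r₀, hr₀⟩ := exists_nat_ge (1 + (4 * C + b) / (ε / 2))
  refine ⟨r₀, fun r hr M => ?_⟩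
  have h1 := hmain M r
  simp only [Finset.sum_apply] at h1
  have h2 : ∀ k, (kerOp K)^[k] (fun u : ℕ => ENNReal.ofReal (1 - 2 * δ) * (u : ℝ≥0∞)) r =
      ENNReal.ofReal (1 - 2 * δ) * (kerOp K)^[k] (fun u : ℕ => (u : ℝ≥0∞)) r := fun k => by
    rw [iterate_kerOp_const_mul]
  simp only [h2, ← Finset.mul_sum] at h1
  have hpos : 0 < ENNReal.ofReal (1 - 2 * δ) := ENNReal.ofReal_pos.2 (by linarith)
  refine (ENNReal.mul_le_mul_iff_right hpos.ne' ENNReal.ofReal_ne_top).1 (h1.trans ?_)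
  rw [← ENNReal.ofReal_mul (by linarith)]
  refine ENNReal.ofReal_le_ofReal ?_
  have hrr : 1 + (4 * C + b) / (ε / 2) ≤ r := hr₀.trans (by exact_mod_cast hr)
  have hq : 0 ≤ (4 * C + b) / (ε / 2) := by positivity
  have hr1 : (1 : ℝ) ≤ r := by linarith
  have h3 : 4 * C + b ≤ ε / 2 * r := by
    have : (4 * C + b) / (ε / 2) ≤ r := by linarith
    rwa [div_le_iff₀' (by positivity)] at this
  have h4 : V r ≤ r ^ 2 + (4 * C + b) * r := by
    have : (if r = 0 then (0 : ℝ) else 1) ≤ 1 := by split_ifs <;> norm_num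
    simp only [hV]
    nlinarith
  nlinarith

/-- Lower deviations of the absorbed chain from its mean-field trajectory. -/
lemma iterate_deficit_sq_le (hK : CriticalKernel K C) {ε : ℝ} (hε : 0 < ε) :
    ∃ r₀ : ℕ, ∀ r ≥ r₀, ∀ k : ℕ,
      (kerOp K)^[k] (fun u => ENNReal.ofReal (max ((r : ℝ) - k / 2 - u) 0 ^ 2)) r ≤
        ENNReal.ofReal (ε * r ^ 2) := by
  have hC := hK.C_nonneg
  set m : ℕ → ℝ := fun d => ∑' j : ℕ, K d j * ((j : ℝ) - d) with hm
  obtain ⟨d₀, hd₀⟩ : ∃ d₀, ∀ d ≥ d₀, -(1 / 2) - ε / 8 ≤ m d := by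
    refine eventually_atTop.1 ((hK.tendsto_mean.eventually (eventually_ge_nhds ?_)))
    linarith
  obtain ⟨α, hα, hαK⟩ := hK.exists_pos_le_zero d₀
  set C' : ℝ := 2 * C + 2 with hC'
  set B : ℝ := (2 * (1 + C)) / α with hB
  have hB0 : 0 ≤ B := by positivity
  have key : ∀ (r : ℕ) (a : ℝ), a ≤ r → ∀ u,
      kerOp K (fun u => ENNReal.ofReal (max (a - 1 / 2 - u) 0 ^ 2 +
        B * r * (if u = 0 then 0 else 1))) u ≤
      ENNReal.ofReal (max (a - u) 0 ^ 2 + B * r * (if u = 0 then 0 else 1)) +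
        ENNReal.ofReal (ε / 4 * r + C') := by
    intro r a har d
    have hr0 : (0 : ℝ) ≤ r := Nat.cast_nonneg r
    have hi : ∀ u : ℕ, (0 : ℝ) ≤ if u = 0 then 0 else 1 := fun u => by split_ifs <;> norm_num
    rw [← ENNReal.ofReal_add (by have := hi d; positivity) (by positivity)]
    obtain ⟨s, hs, hsum⟩ := hK.hasSum_sq d
    set x := max (a - d) 0 with hx
    have hx0 : 0 ≤ x := le_max_right _ _
    have hxr : x ≤ r := max_le (by have : (0 : ℝ) ≤ d := Nat.cast_nonneg d; linarith) hr0
    have h1 : HasSum (fun j : ℕ => K d j * ((x + (-((j : ℝ) - d) - 1 / 2)) ^ 2 +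
        B * r * (if j = 0 then 0 else 1)))
        (s + (1 - 2 * x) * m d + (x - 1 / 2) ^ 2 * 1 + B * r * (1 - K d 0)) := by
      convert ((hsum.add ((hK.hasSum_mean d).mul_left (1 - 2 * x))).add
        ((hK.hasSum_one d).mul_left ((x - 1 / 2) ^ 2))).add
        ((hK.hasSum_pos_indicator d).mul_left (B * r)) using 1
      funext j
      ring
    rcases Nat.eq_zero_or_pos d with rfl | hd
    · have h2 : HasSum (fun j : ℕ => K 0 j * (max (a - 1 / 2 - j) 0 ^ 2 +
          B * r * (if j = 0 then 0 else 1))) (max (a - 1 / 2) 0 ^ 2) := by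
        convert hasSum_ite_eq 0 (max (a - 1 / 2) 0 ^ 2) using 1
        funext j
        by_cases hj : j = 0 <;> simp [hK.absorbing, hj]
      rw [hK.kerOp_ofReal (fun j => by have := hi j; positivity) h2]
      refine ENNReal.ofReal_le_ofReal ?_
      have h3 : max (a - 1 / 2) 0 ^ 2 ≤ x ^ 2 := by
        rw [hx]; gcongr; simp
      have : 0 ≤ ε / 4 * r + C' := by positivity
      rw [if_pos rfl, mul_zero]
      linarith
    · refine (kerOp_mono (Ψ := fun j : ℕ => ENNReal.ofReal ((x + (-((j : ℝ) - d) - 1 / 2)) ^ 2 +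
        B * r * (if j = 0 then 0 else 1))) (fun j => ?_) d).trans ?_
      · refine ENNReal.ofReal_le_ofReal (add_le_add ?_ le_rfl)
        have h2 : max (a - 1 / 2 - j) 0 ≤ |x + (-((j : ℝ) - d) - 1 / 2)| := by
          refine max_le (le_trans ?_ (le_abs_self _)) (abs_nonneg _)
          have : a - d ≤ x := le_max_left _ _
          linarith
        calc max (a - 1 / 2 - j) 0 ^ 2 ≤ |x + (-((j : ℝ) - d) - 1 / 2)| ^ 2 := by
              gcongr
          _ = _ := sq_abs _
      · rw [hK.kerOp_ofReal (fun j => by have := hi j; positivity) h1]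
        refine ENNReal.ofReal_le_ofReal ?_
        rw [if_neg hd.ne']
        have hmd := abs_le.1 (hK.abs_mean_le d)
        change -(1 + C) ≤ m d ∧ m d ≤ 1 + C at hmd
        by_cases hdd : d₀ ≤ d
        · have h3 := hd₀ d hdd
          have h4 : 0 ≤ B * r * K d 0 := mul_nonneg (by positivity) (hK.nonneg _ _)
          have h5 : x * (-(1 / 2) - ε / 8) ≤ x * m d := by gcongr
          have h6 : ε * x ≤ ε * r := by gcongr
          nlinarith
        · have h3 := hαK d (by omega)
          have h4 : B * r * α ≤ B * r * K d 0 := by gcongr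
          have h5 : B * r * α = 2 * (1 + C) * r := by rw [hB]; field_simp
          have h6 : x * (-(1 + C)) ≤ x * m d := by gcongr; exact hmd.1
          have h7 : (1 + C) * x ≤ (1 + C) * r := by gcongr
          have h8 : 0 ≤ ε * r := by positivity
          nlinarith
  have hiter : ∀ r k : ℕ, (kerOp K)^[k] (fun u => ENNReal.ofReal (max ((r : ℝ) - k / 2 - u) 0 ^ 2 +
        B * r * (if u = 0 then 0 else 1))) r ≤
      ENNReal.ofReal (B * r) + k * ENNReal.ofReal (ε / 4 * r + C') := by
    intro r k
    induction k with
    | zero =>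
      simp only [Function.iterate_zero, id, Nat.cast_zero, zero_div, sub_zero, sub_self, max_self,
        zero_mul, add_zero]
      refine ENNReal.ofReal_le_ofReal ?_
      split_ifs with h
      · simp [h]
      · simp
    | succ k ih =>
      have h1 : kerOp K (fun u : ℕ => ENNReal.ofReal (max ((r : ℝ) - (k + 1 : ℕ) / 2 - u) 0 ^ 2 +
          B * r * (if u = 0 then 0 else 1))) ≤
          (fun u : ℕ => ENNReal.ofReal (max ((r : ℝ) - k / 2 - u) 0 ^ 2 +
            B * r * (if u = 0 then 0 else 1))) + fun _ => ENNReal.ofReal (ε / 4 * r + C') := by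
        intro u
        have h2 := key r ((r : ℝ) - k / 2) (by
          have : (0 : ℝ) ≤ k := Nat.cast_nonneg k
          linarith) u
        have h3 : (r : ℝ) - (k + 1 : ℕ) / 2 = (r : ℝ) - k / 2 - 1 / 2 := by push_cast; ring
        rw [h3]
        exact h2
      rw [Function.iterate_succ_apply]
      refine (iterate_kerOp_mono h1 k r).trans ?_
      rw [iterate_kerOp_add, hK.iterate_kerOp_const]
      refine (add_le_add ih le_rfl).trans (le_of_eq ?_)
      push_cast
      ring
  obtain ⟨r₀, hr₀⟩ := exists_nat_ge ((B + 2 * C') / (ε / 2))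
  refine ⟨r₀, fun r hr k => ?_⟩
  have hr0 : (0 : ℝ) ≤ r := Nat.cast_nonneg r
  by_cases hk : 2 * r ≤ k
  · have h0 : (fun u : ℕ => ENNReal.ofReal (max ((r : ℝ) - k / 2 - u) 0 ^ 2)) =
        fun _ => 0 := by
      funext u
      have h1 : (2 * r : ℝ) ≤ k := by exact_mod_cast hk
      rw [max_eq_right]
      · simp
      · have : (0 : ℝ) ≤ u := Nat.cast_nonneg u
        linarith
    rw [h0, hK.iterate_kerOp_const]
    exact zero_le
  · refine (iterate_kerOp_mono (fun u => ENNReal.ofReal_le_ofReal ?_) k r).trans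
      ((hiter r k).trans ?_)
    · refine le_add_of_nonneg_right (mul_nonneg (by positivity) ?_)
      split_ifs <;> norm_num
    · rw [← ENNReal.ofReal_natCast, ← ENNReal.ofReal_mul (Nat.cast_nonneg k),
        ← ENNReal.ofReal_add (by positivity) (by positivity)]
      refine ENNReal.ofReal_le_ofReal ?_
      have h1 : (k : ℝ) ≤ 2 * r := by exact_mod_cast (by omega : k ≤ 2 * r)
      have h2 : B + 2 * C' ≤ ε / 2 * r := by
        have : (B + 2 * C') / (ε / 2) ≤ r := hr₀.trans (by exact_mod_cast hr)
        rwa [div_le_iff₀' (by positivity)] at this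
      have h3 : (k : ℝ) * (ε / 4 * r + C') ≤ 2 * r * (ε / 4 * r + C') := by gcongr
      nlinarith

lemma iterate_deficit_le (hK : CriticalKernel K C) {ε : ℝ} (hε : 0 < ε) :
    ∃ r₀ : ℕ, ∀ r ≥ r₀, ∀ k : ℕ,
      (kerOp K)^[k] (fun u => ENNReal.ofReal (max ((r : ℝ) - k / 2 - u) 0)) r ≤
        ENNReal.ofReal (ε * r) := by
  obtain ⟨r₀, h⟩ := hK.iterate_deficit_sq_le (ε := ε ^ 2) (by positivity)
  refine ⟨r₀ + 1, fun r hr k => ?_⟩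
  have hr1 : (0 : ℝ) < r := by exact_mod_cast (by omega : 0 < r)
  have h1 : (fun u : ℕ => ENNReal.ofReal (max ((r : ℝ) - k / 2 - u) 0)) ≤
      (fun u : ℕ => ENNReal.ofReal (1 / (2 * ε * r)) *
        ENNReal.ofReal (max ((r : ℝ) - k / 2 - u) 0 ^ 2)) +
        fun _ : ℕ => ENNReal.ofReal (ε * r / 2) := by
    intro u
    rw [Pi.add_apply, ← ENNReal.ofReal_mul (by positivity), ← ENNReal.ofReal_add (by positivity)
      (by positivity)]
    refine ENNReal.ofReal_le_ofReal ?_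
    set y := max ((r : ℝ) - k / 2 - u) 0
    have : 1 / (2 * ε * r) * y ^ 2 + ε * r / 2 - y = 1 / (2 * ε * r) * (y - ε * r) ^ 2 := by
      field_simp
      ring
    have h2 : 0 ≤ 1 / (2 * ε * r) * (y - ε * r) ^ 2 := by positivity
    linarith
  refine (iterate_kerOp_mono h1 k r).trans ?_
  rw [iterate_kerOp_add, hK.iterate_kerOp_const, iterate_kerOp_const_mul]
  refine (add_le_add (mul_le_mul_right (h r (by omega) k) _) le_rfl).trans ?_
  rw [← ENNReal.ofReal_mul (by positivity), ← ENNReal.ofReal_add (by positivity)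
    (by positivity)]
  refine ENNReal.ofReal_le_ofReal (le_of_eq ?_)
  field_simp
  ring

end CriticalKernel

end KerOp

/-- Expectation of `Φ` at the total number of steps away from the root from a site, when the total
number of steps toward the root reaches `t`, given that `a` steps toward the root and `b` steps
away from it have already been made. -/
def siteOp (w : ℤ → ℝ) (a b : ℕ) (Φ : ℕ → ℝ≥0∞) (t : ℕ) : ℝ≥0∞ :=
  ∑' j, ENNReal.ofReal (upLaw w (t - a) ((b : ℤ) - a) j) * Φ (b + j)

/-- Composition of the operators `siteOp` along the consecutive sites `i, …, i + K - 1` of a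
half-line. -/
def nestOp (w : ℤ → ℝ) (a b : ℕ → ℕ) (Φ : ℕ → ℝ≥0∞) : ℕ → ℕ → ℕ → ℝ≥0∞
  | 0, _, t => Φ t
  | K + 1, i, t => siteOp w (a i) (b i) (fun u => nestOp w a b Φ K (i + 1) u) t

section Nest

variable {w : ℤ → ℝ} {Φ : ℕ → ℝ≥0∞} {a b : ℕ → ℕ}

lemma siteOp_zero_zero : siteOp w 0 0 Φ = kerOp (fun d j => upLaw w d 0 j) Φ := by
  funext t
  simp [siteOp, kerOp]

lemma siteOp_of_le {a b t : ℕ} (h : t ≤ a) : siteOp w a b Φ t = Φ b := by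
  rw [siteOp, Nat.sub_eq_zero_of_le h, tsum_eq_single 0]
  · simp [upLaw]
  · intro j hj
    simp [upLaw, hj]

lemma siteOp_first_step (hw : ∀ z, 0 < w z) {a b t : ℕ} (h : a < t) :
    siteOp w a b Φ t = ENNReal.ofReal (downProb w ((b : ℤ) - a)) * siteOp w (a + 1) b Φ t +
      ENNReal.ofReal (upProb w ((b : ℤ) - a)) * siteOp w a (b + 1) Φ t := by
  obtain ⟨d, hd⟩ : ∃ d, t - a = d + 1 := ⟨t - a - 1, by omega⟩
  have hd' : t - (a + 1) = d := by omega
  have e1 : (b : ℤ) - ((a + 1 : ℕ) : ℤ) = (b : ℤ) - a - 1 := by push_cast; ring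
  have e2 : ((b + 1 : ℕ) : ℤ) - (a : ℤ) = (b : ℤ) - a + 1 := by push_cast; ring
  simp only [siteOp, hd, hd', e1, e2]
  set z : ℤ := (b : ℤ) - a
  have hq := (downProb_pos hw z).le
  have hp := (upProb_pos hw z).le
  rw [tsum_eq_zero_add' ENNReal.summable,
    tsum_eq_zero_add' (f := fun j => ENNReal.ofReal (upLaw w d (z - 1) j) * Φ (b + j))
      ENNReal.summable, mul_add, upLaw_succ_zero, ENNReal.ofReal_mul hq, add_assoc,
    ← ENNReal.tsum_mul_left, ← ENNReal.tsum_mul_left, ← ENNReal.tsum_add, mul_assoc]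
  congr 1
  refine tsum_congr fun j => ?_
  rw [upLaw_succ_succ, ENNReal.ofReal_add (mul_nonneg hq (upLaw_nonneg hw _ _ _))
    (mul_nonneg hp (upLaw_nonneg hw _ _ _)), ENNReal.ofReal_mul hq, ENNReal.ofReal_mul hp,
    add_mul, mul_assoc, mul_assoc, show b + 1 + j = b + (j + 1) by ring]

lemma le_siteOp (hw : ∀ z, 0 < w z) (hm : Monotone w) {c : ℝ≥0∞} {a b t : ℕ}
    (h : ∀ j, c ≤ Φ (b + j)) : c ≤ siteOp w a b Φ t := by
  have h1 : ∑' j, ENNReal.ofReal (upLaw w (t - a) ((b : ℤ) - a) j) = 1 := by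
    have h2 := hasSum_upLaw hw hm (t - a) ((b : ℤ) - a)
    rw [← ENNReal.ofReal_tsum_of_nonneg (upLaw_nonneg hw _ _) h2.summable, h2.tsum_eq,
      ENNReal.ofReal_one]
  calc c = ∑' j, ENNReal.ofReal (upLaw w (t - a) ((b : ℤ) - a) j) * c := by
        rw [ENNReal.tsum_mul_right, h1, one_mul]
    _ ≤ _ := ENNReal.tsum_le_tsum fun j => by gcongr; exact h j

lemma nestOp_congr {a' b' : ℕ → ℕ} {K i : ℕ} (ha : ∀ k ≥ i, a k = a' k) (hb : ∀ k ≥ i, b k = b' k)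
    (t : ℕ) : nestOp w a b Φ K i t = nestOp w a' b' Φ K i t := by
  induction K generalizing i t with
  | zero => rfl
  | succ K ih =>
    simp only [nestOp, ha i le_rfl, hb i le_rfl]
    congr 1
    funext u
    exact ih (fun k hk => ha k (by omega)) (fun k hk => hb k (by omega)) u

lemma nestOp_zero (K i : ℕ) :
    nestOp w (fun _ => 0) (fun _ => 0) Φ K i = (kerOp fun d j => upLaw w d 0 j)^[K] Φ := by
  induction K generalizing i with
  | zero => rfl
  | succ K ih =>
    funext t
    rw [nestOp, siteOp_zero_zero, Function.iterate_succ_apply', ← ih (i + 1)]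

lemma nestOp_of_le {K i t : ℕ} (h : t ≤ a i) (hs : ∀ k ≥ i, b k ≤ a (k + 1)) :
    nestOp w a b Φ (K + 1) i t = Φ (b (i + K)) := by
  induction K generalizing i t with
  | zero => rw [nestOp, siteOp_of_le h]; rfl
  | succ K ih =>
    rw [nestOp, siteOp_of_le h, ih (hs i le_rfl) fun k hk => hs k (by omega)]
    congr 2
    omega

lemma le_nestOp (hw : ∀ z, 0 < w z) (hm : Monotone w) (hΦ : Monotone Φ) (K i t : ℕ) :
    Φ (b (i + K)) ≤ nestOp w a b Φ (K + 1) i t := by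
  induction K generalizing i t with
  | zero => exact le_siteOp hw hm fun j => hΦ (by simp)
  | succ K ih =>
    rw [nestOp]
    refine le_siteOp hw hm fun j => ?_
    have := ih (i + 1) (b i + j)
    rwa [show i + 1 + K = i + (K + 1) by ring] at this

/-- The nested expectations are harmonic with respect to a step of a walker at the site `x`. -/
lemma nestOp_first_step (hw : ∀ z, 0 < w z) {x : ℕ} {i t : ℕ} (K : ℕ) (hx : i ≤ x)
    (h1 : x = i → a i < t) (h2 : i < x → a x < b (x - 1)) :
    nestOp w a b Φ K i t =
      ENNReal.ofReal (downProb w ((b x : ℤ) - a x)) *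
        nestOp w (Function.update a x (a x + 1)) b Φ K i t +
      ENNReal.ofReal (upProb w ((b x : ℤ) - a x)) *
        nestOp w a (Function.update b x (b x + 1)) Φ K i t := by
  have hq := (downProb_pos hw ((b x : ℤ) - a x)).le
  have hp := (upProb_pos hw ((b x : ℤ) - a x)).le
  induction K generalizing i t with
  | zero =>
    simp only [nestOp]
    rw [← add_mul, ← ENNReal.ofReal_add hq hp, downProb_add_upProb hw, ENNReal.ofReal_one, one_mul]
  | succ K ih =>
    rcases hx.eq_or_lt with rfl | hx'
    · simp only [nestOp, Function.update_self]
      rw [siteOp_first_step hw (h1 rfl)]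
      have e1 : ∀ u, nestOp w (Function.update a i (a i + 1)) b Φ K (i + 1) u =
          nestOp w a b Φ K (i + 1) u := nestOp_congr
        (fun k hk => Function.update_of_ne (by omega) _ _) fun _ _ => rfl
      have e2 : ∀ u, nestOp w a (Function.update b i (b i + 1)) Φ K (i + 1) u =
          nestOp w a b Φ K (i + 1) u := nestOp_congr
        (fun _ _ => rfl) fun k hk => Function.update_of_ne (by omega) _ _
      simp only [e1, e2]
    · simp only [nestOp, Function.update_of_ne hx'.ne]
      simp only [siteOp]
      rw [← ENNReal.tsum_mul_left, ← ENNReal.tsum_mul_left, ← ENNReal.tsum_add]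
      refine tsum_congr fun j => ?_
      rw [ih (i := i + 1) (t := b i + j) hx' (fun hxi => ?_) fun h => h2 hx']
      · ring
      · have := h2 hx'
        rw [hxi, Nat.add_sub_cancel] at this
        omega

end Nest

/-- The position of the walk together with its directed local times and the elapsed time. -/
structure WalkState where
  pos : ℤ
  U : ℤ → ℕ
  D : ℤ → ℕ
  t : ℕ

namespace WalkState

/-- The initial state of the walk. -/
def init : WalkState := ⟨0, fun _ => 0, fun _ => 0, 0⟩

/-- The state after a step up. -/
def up (c : WalkState) : WalkState :=
  ⟨c.pos + 1, Function.update c.U c.pos (c.U c.pos + 1), c.D, c.t + 1⟩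

/-- The state after a step down. -/
def dn (c : WalkState) : WalkState :=
  ⟨c.pos - 1, c.U, Function.update c.D c.pos (c.D c.pos + 1), c.t + 1⟩

/-- The local drift variable at the current position. -/
def drift (c : WalkState) : ℤ := (c.U c.pos : ℤ) - c.D c.pos

/-- Total number of steps made from the site `k`. -/
def visits (k : ℤ) (c : WalkState) : ℕ := c.U k + c.D k

/-- Invariants of the states reachable from `init`. -/
structure Valid (c : WalkState) : Prop where
  flow : ∀ k, (c.U k : ℤ) - c.D (k + 1) =
    (if 0 ≤ k ∧ k < c.pos then 1 else 0) - (if c.pos ≤ k ∧ k < 0 then 1 else 0)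
  abs_pos_le : |c.pos| ≤ c.t
  sum_visits : ∀ M : ℕ, c.t ≤ M → ∑ k ∈ Finset.Icc (-(M : ℤ)) M, c.visits k = c.t

lemma valid_init : init.Valid where
  flow k := by simp only [init]; split_ifs <;> omega
  abs_pos_le := by simp [init]
  sum_visits M _ := by simp [init, visits]

lemma visits_up (k : ℤ) (c : WalkState) :
    c.up.visits k = c.visits k + if k = c.pos then 1 else 0 := by
  by_cases h : k = c.pos
  · subst h; simp [visits, up]; omega
  · simp [visits, up, h]

lemma visits_dn (k : ℤ) (c : WalkState) :
    c.dn.visits k = c.visits k + if k = c.pos then 1 else 0 := by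
  by_cases h : k = c.pos
  · subst h; simp [visits, dn]; omega
  · simp [visits, dn, h]

lemma Valid.up {c : WalkState} (h : c.Valid) : c.up.Valid where
  flow k := by
    have h1 := h.flow k
    by_cases hk : k = c.pos
    · subst hk
      simp only [WalkState.up, Function.update_self] at h1 ⊢
      push_cast
      split_ifs at h1 ⊢ <;> omega
    · simp only [WalkState.up, Function.update_of_ne hk] at h1 ⊢
      split_ifs at h1 ⊢ <;> omega
  abs_pos_le := by
    have := abs_le.1 h.abs_pos_le
    rw [abs_le]
    simp only [WalkState.up]
    push_cast
    omega
  sum_visits M hM := by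
    have h2 : c.t + 1 ≤ M := hM
    have h3 := abs_le.1 h.abs_pos_le
    have h4 : c.pos ∈ Finset.Icc (-(M : ℤ)) M := by rw [Finset.mem_Icc]; omega
    simp only [visits_up, Finset.sum_add_distrib, h.sum_visits M (by omega)]
    rw [Finset.sum_ite_eq' _ c.pos, if_pos h4]
    rfl

lemma Valid.dn {c : WalkState} (h : c.Valid) : c.dn.Valid where
  flow k := by
    have h1 := h.flow k
    by_cases hk : k + 1 = c.pos
    · simp only [WalkState.dn, hk, Function.update_self] at h1 ⊢
      push_cast
      split_ifs at h1 ⊢ <;> omega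
    · simp only [WalkState.dn, Function.update_of_ne hk] at h1 ⊢
      split_ifs at h1 ⊢ <;> omega
  abs_pos_le := by
    have := abs_le.1 h.abs_pos_le
    rw [abs_le]
    simp only [WalkState.dn]
    push_cast
    omega
  sum_visits M hM := by
    have h2 : c.t + 1 ≤ M := hM
    have h3 := abs_le.1 h.abs_pos_le
    have h4 : c.pos ∈ Finset.Icc (-(M : ℤ)) M := by rw [Finset.mem_Icc]; omega
    simp only [visits_dn, Finset.sum_add_distrib, h.sum_visits M (by omega)]
    rw [Finset.sum_ite_eq' _ c.pos, if_pos h4]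
    rfl

/-- One-step expectation. -/
def step (w : ℤ → ℝ) (f : WalkState → ℝ≥0∞) (c : WalkState) : ℝ≥0∞ :=
  ENNReal.ofReal (upProb w c.drift) * f c.up + ENNReal.ofReal (downProb w c.drift) * f c.dn

open Classical in
/-- Expectation of `f` after `n` steps of the walk started from `c` and stopped upon entering
`S`. -/
def expect (w : ℤ → ℝ) (S : Set WalkState) : ℕ → WalkState → (WalkState → ℝ≥0∞) → ℝ≥0∞
  | 0, c, f => f c
  | n + 1, c, f => if c ∈ S then f c else
      ENNReal.ofReal (upProb w c.drift) * expect w S n c.up f +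
        ENNReal.ofReal (downProb w c.drift) * expect w S n c.dn f

section Expect

variable {w : ℤ → ℝ} {S : Set WalkState} {f g : WalkState → ℝ≥0∞}

lemma ofReal_upProb_add_downProb (hw : ∀ z, 0 < w z) (z : ℤ) :
    ENNReal.ofReal (upProb w z) + ENNReal.ofReal (downProb w z) = 1 := by
  rw [← ENNReal.ofReal_add (upProb_pos hw z).le (downProb_pos hw z).le, add_comm,
    downProb_add_upProb hw, ENNReal.ofReal_one]

lemma expect_mono {I : WalkState → Prop} (hI : ∀ c, I c → c ∉ S → I c.up ∧ I c.dn) {n : ℕ}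
    {c : WalkState} (hc : I c)
    (h : ∀ c', I c' → c'.t ≤ c.t + n → (c' ∈ S ∨ c'.t = c.t + n) → f c' ≤ g c') :
    expect w S n c f ≤ expect w S n c g := by
  induction n generalizing c with
  | zero => exact h c hc le_rfl (Or.inr rfl)
  | succ n ih =>
    simp only [expect]
    split_ifs with hS
    · exact h c hc (Nat.le_add_right _ _) (Or.inl hS)
    · have hu : c.up.t = c.t + 1 := rfl
      have hd : c.dn.t = c.t + 1 := rfl
      have h1 := ih (hI c hc hS).1 fun c' h1 h2 h3 =>
        h c' h1 (by omega) (h3.imp_right fun h4 => by omega)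
      have h2 := ih (hI c hc hS).2 fun c' h1 h2 h3 =>
        h c' h1 (by omega) (h3.imp_right fun h4 => by omega)
      gcongr

lemma expect_le_of_step_le {I : WalkState → Prop} (hI : ∀ c, I c → c ∉ S → I c.up ∧ I c.dn)
    (h : ∀ c, I c → c ∉ S → step w f c ≤ f c) {n : ℕ} {c : WalkState} (hc : I c) :
    expect w S n c f ≤ f c := by
  induction n generalizing c with
  | zero => exact le_rfl
  | succ n ih =>
    simp only [expect]
    split_ifs with hS
    · exact le_rfl
    · refine le_trans ?_ (h c hc hS)
      have h1 := ih (hI c hc hS).1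
      have h2 := ih (hI c hc hS).2
      unfold step
      gcongr

lemma expect_add (n : ℕ) (c : WalkState) :
    expect w S n c (fun c => f c + g c) = expect w S n c f + expect w S n c g := by
  induction n generalizing c with
  | zero => rfl
  | succ n ih =>
    simp only [expect, ih]
    split_ifs
    · rfl
    · ring

lemma expect_const_mul (a : ℝ≥0∞) (n : ℕ) (c : WalkState) :
    expect w S n c (fun c => a * f c) = a * expect w S n c f := by
  induction n generalizing c with
  | zero => rfl
  | succ n ih =>
    simp only [expect, ih]
    split_ifs
    · rfl
    · ring

lemma expect_const (hw : ∀ z, 0 < w z) (a : ℝ≥0∞) (n : ℕ) (c : WalkState) :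
    expect w S n c (fun _ => a) = a := by
  induction n generalizing c with
  | zero => rfl
  | succ n ih =>
    simp only [expect, ih]
    split_ifs
    · rfl
    · rw [← add_mul, ofReal_upProb_add_downProb hw, one_mul]

lemma expect_sum {ι : Type*} (s : Finset ι) (F : ι → WalkState → ℝ≥0∞) (n : ℕ) (c : WalkState) :
    expect w S n c (fun c => ∑ i ∈ s, F i c) = ∑ i ∈ s, expect w S n c (F i) := by
  classical
  induction s using Finset.induction_on with
  | empty =>
    simp only [Finset.sum_empty]
    have := expect_const_mul (w := w) (S := S) (f := fun _ => 0) 0 n c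
    simpa using this
  | insert i s hi ih => simp only [Finset.sum_insert hi, expect_add, ih]

lemma le_expect (hw : ∀ z, 0 < w z) (h : ∀ c, f c ≤ f c.up ∧ f c ≤ f c.dn) (n : ℕ)
    (c : WalkState) : f c ≤ expect w S n c f := by
  induction n generalizing c with
  | zero => exact le_rfl
  | succ n ih =>
    simp only [expect]
    split_ifs
    · exact le_rfl
    · calc f c = ENNReal.ofReal (upProb w c.drift) * f c +
            ENNReal.ofReal (downProb w c.drift) * f c := by
            rw [← add_mul, ofReal_upProb_add_downProb hw, one_mul]
        _ ≤ _ := by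
            have h1 := (h c).1.trans (ih c.up)
            have h2 := (h c).2.trans (ih c.dn)
            gcongr

lemma expect_le_expect_empty (hw : ∀ z, 0 < w z) (h : ∀ c, f c ≤ f c.up ∧ f c ≤ f c.dn) (n : ℕ)
    (c : WalkState) : expect w S n c f ≤ expect w ∅ n c f := by
  induction n generalizing c with
  | zero => exact le_rfl
  | succ n ih =>
    by_cases hS : c ∈ S
    · have := le_expect (S := ∅) hw h (n + 1) c
      rw [expect, if_pos hS]
      exact this
    · simp only [expect, if_neg hS, Set.mem_empty_iff_false, if_false]
      have h1 := ih c.up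
      have h2 := ih c.dn
      gcongr

lemma expect_empty_succ (n : ℕ) (c : WalkState) :
    expect w ∅ (n + 1) c f = expect w ∅ n c (step w f) := by
  induction n generalizing c with
  | zero => simp [expect, step]
  | succ n ih =>
    rw [expect, if_neg (Set.notMem_empty _), ih, ih]
    simp only [expect, Set.mem_empty_iff_false, if_false]

/-- The expected number of visits is the sum of the occupation probabilities. -/
lemma expect_visits (hw : ∀ z, 0 < w z) (k : ℤ) (n : ℕ) :
    expect w ∅ n init (fun c => (c.visits k : ℝ≥0∞)) =
      ∑ j ∈ Finset.range n, expect w ∅ j init (fun c => if c.pos = k then 1 else 0) := by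
  induction n with
  | zero => simp [expect, init, visits]
  | succ n ih =>
    have hs : step w (fun c => (c.visits k : ℝ≥0∞)) =
        fun c => (c.visits k : ℝ≥0∞) + if c.pos = k then 1 else 0 := by
      funext c
      simp only [step, visits_up, visits_dn, eq_comm (a := k)]
      rw [← add_mul, ofReal_upProb_add_downProb hw, one_mul]
      push_cast
      rfl
    rw [expect_empty_succ, hs, expect_add, ih, Finset.sum_range_succ]

end Expect

end WalkState

namespace WalkState

/-- States in which the walk has made at least `r` steps from `1` to `0`. -/
def returned (r : ℕ) : Set WalkState := {c | r ≤ c.D 1}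

/-- Invariants of the states reachable from `init` by the walk stopped at its `r`-th step from `1`
to `0`. -/
structure ValidUntil (r : ℕ) (c : WalkState) : Prop where
  valid : c.Valid
  D_one_le : c.D 1 ≤ r
  pos_eq : c.D 1 = r → c.pos = 0

lemma validUntil_init (r : ℕ) : init.ValidUntil r :=
  ⟨valid_init, Nat.zero_le _, fun _ => rfl⟩

lemma ValidUntil.up_dn {r : ℕ} (c : WalkState) (h : c.ValidUntil r) (hS : c ∉ returned r) :
    c.up.ValidUntil r ∧ c.dn.ValidUntil r := by
  have h1 : c.D 1 < r := not_le.1 hS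
  refine ⟨⟨h.valid.up, h1.le, fun h2 => absurd h2 h1.ne⟩, ⟨h.valid.dn, ?_, ?_⟩⟩
  · by_cases hp : c.pos = 1
    · simp only [dn, hp, Function.update_self]; omega
    · simp only [dn, Function.update_of_ne (Ne.symm hp)]; omega
  · intro h2
    by_cases hp : c.pos = 1
    · simp [dn, hp]
    · simp only [dn, Function.update_of_ne (Ne.symm hp)] at h2; omega

/-- In a stopped state every edge has been crossed equally often in both directions. -/
lemma ValidUntil.U_eq {r : ℕ} {c : WalkState} (h : c.ValidUntil r) (hS : c ∈ returned r) (k : ℤ) :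
    c.U k = c.D (k + 1) := by
  have h1 := h.valid.flow k
  rw [h.pos_eq (le_antisymm h.D_one_le hS)] at h1
  split_ifs at h1 <;> omega

lemma ValidUntil.D_one_eq {r : ℕ} {c : WalkState} (h : c.ValidUntil r) (hS : c ∈ returned r) :
    c.D 1 = r := le_antisymm h.D_one_le hS

/-- Nested expectation along the sites `1, …, K`. -/
def rightNest (w : ℤ → ℝ) (r K : ℕ) (Φ : ℕ → ℝ≥0∞) (c : WalkState) : ℝ≥0∞ :=
  nestOp w (fun i => c.D (i + 1)) (fun i => c.U (i + 1)) Φ K 0 r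

/-- Nested expectation along the sites `0, …, -K + 1`. -/
def leftNest (w : ℤ → ℝ) (r K : ℕ) (Φ : ℕ → ℝ≥0∞) (c : WalkState) : ℝ≥0∞ :=
  nestOp w (fun i => c.U (-i)) (fun i => c.D (-i)) Φ K 0 r

variable {w : ℤ → ℝ} {Φ : ℕ → ℝ≥0∞}

lemma update_comp_natCast_add_one (F : ℤ → ℕ) (x v : ℕ) :
    (fun i : ℕ => Function.update F ((x : ℤ) + 1) v (i + 1)) =
      Function.update (fun i : ℕ => F (i + 1)) x v := by
  funext i
  by_cases h : i = x
  · subst h; simp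
  · rw [Function.update_of_ne h, Function.update_of_ne (by omega)]

lemma update_comp_neg_natCast (F : ℤ → ℕ) (x v : ℕ) :
    (fun i : ℕ => Function.update F (-(x : ℤ)) v (-i)) =
      Function.update (fun i : ℕ => F (-i)) x v := by
  funext i
  by_cases h : i = x
  · subst h; simp
  · rw [Function.update_of_ne h, Function.update_of_ne (by omega)]

lemma step_rightNest (hw : ∀ z, 0 < w z) {r : ℕ} (K : ℕ) (c : WalkState) (h : c.ValidUntil r)
    (hS : c ∉ returned r) : step w (rightNest w r K Φ) c = rightNest w r K Φ c := by
  have hD : c.D 1 < r := not_le.1 hS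
  rcases le_or_gt c.pos 0 with hp | hp
  · have e1 : rightNest w r K Φ c.up = rightNest w r K Φ c := nestOp_congr (fun k _ => rfl)
      (fun k _ => by simp only [up]; rw [Function.update_of_ne (by omega)]) _
    have e2 : rightNest w r K Φ c.dn = rightNest w r K Φ c := nestOp_congr
      (fun k _ => by simp only [dn]; rw [Function.update_of_ne (by omega)]) (fun k _ => rfl) _
    rw [step, e1, e2, ← add_mul, ofReal_upProb_add_downProb hw, one_mul]
  · obtain ⟨x, hx⟩ : ∃ x : ℕ, c.pos = (x : ℤ) + 1 := ⟨(c.pos - 1).toNat, by omega⟩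
    have h1 := nestOp_first_step (a := fun i : ℕ => c.D (i + 1)) (b := fun i : ℕ => c.U (i + 1))
      (Φ := Φ) hw (x := x) (i := 0) (t := r) K (Nat.zero_le _) (fun _ => by simpa using hD)
      (fun hx0 => by
        have h2 := h.valid.flow x
        rw [if_pos (by omega), if_neg (by omega)] at h2
        have h3 : ((x - 1 : ℕ) : ℤ) + 1 = x := by omega
        simp only [h3]
        omega)
    rw [step, rightNest, rightNest, rightNest, h1, add_comm]
    simp only [drift, up, dn, hx, update_comp_natCast_add_one]

lemma step_leftNest (hw : ∀ z, 0 < w z) {r : ℕ} (K : ℕ) (c : WalkState) (h : c.ValidUntil r)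
    (hS : c ∉ returned r) : step w (leftNest w r K Φ) c = leftNest w r K Φ c := by
  have hD : c.D 1 < r := not_le.1 hS
  rcases le_or_gt c.pos 0 with hp | hp
  · obtain ⟨x, hx⟩ : ∃ x : ℕ, c.pos = -(x : ℤ) := ⟨(-c.pos).toNat, by omega⟩
    have h1 := nestOp_first_step (a := fun i : ℕ => c.U (-i)) (b := fun i : ℕ => c.D (-i))
      (Φ := Φ) hw (x := x) (i := 0) (t := r) K (Nat.zero_le _)
      (fun hx0 => by
        subst hx0
        have h2 := h.valid.flow 0
        rw [if_neg (by omega), if_neg (by omega)] at h2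
        simp only [zero_add] at h2
        simp only [Nat.cast_zero, neg_zero]
        omega)
      (fun hx0 => by
        have h2 := h.valid.flow (-x)
        rw [if_neg (by omega), if_pos (by omega)] at h2
        have h3 : -(x : ℤ) + 1 = -((x - 1 : ℕ) : ℤ) := by omega
        rw [h3] at h2
        omega)
    have e1 : (c.D (-(x : ℤ)) : ℤ) - c.U (-(x : ℤ)) = -((c.U (-(x : ℤ)) : ℤ) - c.D (-(x : ℤ))) := by
      ring
    rw [step, leftNest, leftNest, leftNest, h1, e1, downProb_neg, upProb_neg]
    simp only [drift, up, dn, hx, update_comp_neg_natCast]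
  · have e1 : leftNest w r K Φ c.up = leftNest w r K Φ c := nestOp_congr
      (fun k _ => by simp only [up]; rw [Function.update_of_ne (by omega)]) (fun k _ => rfl) _
    have e2 : leftNest w r K Φ c.dn = leftNest w r K Φ c := nestOp_congr (fun k _ => rfl)
      (fun k _ => by simp only [dn]; rw [Function.update_of_ne (by omega)]) _
    rw [step, e1, e2, ← add_mul, ofReal_upProb_add_downProb hw, one_mul]

lemma expect_le_rightNest (hw : ∀ z, 0 < w z) {r : ℕ} (K n : ℕ) {f : WalkState → ℝ≥0∞}
    (hf : ∀ c, ValidUntil r c → f c ≤ rightNest w r K Φ c) :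
    expect w (returned r) n init f ≤ (kerOp fun d j => upLaw w d 0 j)^[K] Φ r := by
  refine (expect_mono (I := ValidUntil r) ValidUntil.up_dn (validUntil_init r)
    fun c h _ _ => hf c h).trans ((expect_le_of_step_le (I := ValidUntil r) ValidUntil.up_dn
      (fun c h hS => (step_rightNest hw K c h hS).le) (validUntil_init r)).trans_eq ?_)
  rw [rightNest, ← nestOp_zero K 0]
  rfl

lemma expect_le_leftNest (hw : ∀ z, 0 < w z) {r : ℕ} (K n : ℕ) {f : WalkState → ℝ≥0∞}
    (hf : ∀ c, ValidUntil r c → f c ≤ leftNest w r K Φ c) :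
    expect w (returned r) n init f ≤ (kerOp fun d j => upLaw w d 0 j)^[K] Φ r := by
  refine (expect_mono (I := ValidUntil r) ValidUntil.up_dn (validUntil_init r)
    fun c h _ _ => hf c h).trans ((expect_le_of_step_le (I := ValidUntil r) ValidUntil.up_dn
      (fun c h hS => (step_leftNest hw K c h hS).le) (validUntil_init r)).trans_eq ?_)
  rw [leftNest, ← nestOp_zero K 0]
  rfl

open Classical in
lemma expect_returned_U_le (hw : ∀ z, 0 < w z) (r K n : ℕ) (Φ : ℕ → ℝ≥0∞) :
    expect w (returned r) n init (fun c => if c ∈ returned r then Φ (c.U (K + 1)) else 0) ≤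
      (kerOp fun d j => upLaw w d 0 j)^[K + 1] Φ r := by
  refine expect_le_rightNest hw _ _ fun c h => ?_
  split_ifs with hS
  · rw [rightNest, nestOp_of_le, zero_add]
    · have : r ≤ c.D 1 := hS
      simpa using this
    · exact fun k _ => (h.U_eq hS _).le
  · exact zero_le

open Classical in
lemma expect_returned_D_le (hw : ∀ z, 0 < w z) (r K n : ℕ) (Φ : ℕ → ℝ≥0∞) :
    expect w (returned r) n init (fun c => if c ∈ returned r then Φ (c.D (-K)) else 0) ≤
      (kerOp fun d j => upLaw w d 0 j)^[K + 1] Φ r := by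
  refine expect_le_leftNest hw _ _ fun c h => ?_
  split_ifs with hS
  · rw [leftNest, nestOp_of_le, zero_add]
    · have := h.U_eq hS 0
      have := h.D_one_eq hS
      simp only [Nat.cast_zero, neg_zero]
      simp only [zero_add] at *
      omega
    · intro k _
      rw [h.U_eq hS]
      refine (congrArg c.D ?_).le
      push_cast
      ring
  · exact zero_le

lemma expect_U_le (hw : ∀ z, 0 < w z) (hm : Monotone w) (hΦ : Monotone Φ) (r K n : ℕ) :
    expect w (returned r) n init (fun c => Φ (c.U (K + 1))) ≤
      (kerOp fun d j => upLaw w d 0 j)^[K + 1] Φ r :=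
  expect_le_rightNest hw _ _ fun c _ => by
    have := le_nestOp (a := fun i : ℕ => c.D (i + 1)) (b := fun i : ℕ => c.U (i + 1))
      hw hm hΦ K 0 r
    rwa [zero_add] at this

lemma expect_D_le (hw : ∀ z, 0 < w z) (hm : Monotone w) (hΦ : Monotone Φ) (r K n : ℕ) :
    expect w (returned r) n init (fun c => Φ (c.D (-K))) ≤
      (kerOp fun d j => upLaw w d 0 j)^[K + 1] Φ r :=
  expect_le_leftNest hw _ _ fun c _ => by
    have := le_nestOp (a := fun i : ℕ => c.U (-i)) (b := fun i : ℕ => c.D (-i))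
      hw hm hΦ K 0 r
    rwa [zero_add] at this

end WalkState

lemma sum_Icc_neg {M : Type*} [AddCommMonoid M] (f : ℤ → M) (n : ℕ) :
    ∑ k ∈ Finset.Icc (-(n : ℤ)) n, f k =
      ∑ i ∈ Finset.range n, f (i + 1) + ∑ i ∈ Finset.range (n + 1), f (-i) := by
  induction n with
  | zero => simp
  | succ n ih =>
    have h : Finset.Icc (-((n + 1 : ℕ) : ℤ)) ((n + 1 : ℕ) : ℤ) =
        insert ((n : ℤ) + 1) (insert (-((n + 1 : ℕ) : ℤ)) (Finset.Icc (-(n : ℤ)) n)) := by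
      ext k
      simp only [Finset.mem_Icc, Finset.mem_insert]
      omega
    rw [h, Finset.sum_insert, Finset.sum_insert, ih,
      Finset.sum_range_succ (fun i : ℕ => f ((i : ℤ) + 1)) n,
      Finset.sum_range_succ (fun i : ℕ => f (-(i : ℤ))) (n + 1)]
    · abel
    · simp only [Finset.mem_Icc]; omega
    · simp only [Finset.mem_Icc, Finset.mem_insert]; omega

lemma ofReal_sum_le_sum_ofReal {ι : Type*} (s : Finset ι) (f : ι → ℝ) :
    ENNReal.ofReal (∑ i ∈ s, f i) ≤ ∑ i ∈ s, ENNReal.ofReal (f i) := by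
  classical
  induction s using Finset.induction_on with
  | empty => simp
  | insert i s hi ih =>
    rw [Finset.sum_insert hi, Finset.sum_insert hi]
    exact ENNReal.ofReal_add_le.trans (add_le_add le_rfl ih)

lemma sum_Icc_neg_sub_abs (n : ℕ) :
    ∑ k ∈ Finset.Icc (-(n : ℤ)) n, ((n : ℝ) - |(k : ℝ)|) = n ^ 2 := by
  have h : ∀ (c : ℝ) (n : ℕ), ∑ i ∈ Finset.range n, (c - i) = n * c - n * (n - 1) / 2 := by
    intro c n
    induction n with
    | zero => simp
    | succ n ih => rw [Finset.sum_range_succ, ih]; push_cast; ring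
  have h1 : ∀ i ∈ Finset.range n, (n : ℝ) - |(((i : ℤ) + 1 : ℤ) : ℝ)| = (n - 1) - i := by
    intro i _
    push_cast
    rw [abs_of_nonneg (by positivity)]
    ring
  have h2 : ∀ i ∈ Finset.range (n + 1), (n : ℝ) - |((-(i : ℤ) : ℤ) : ℝ)| = n - i := by
    intro i _
    push_cast
    rw [abs_neg, abs_of_nonneg (by positivity)]
  rw [sum_Icc_neg, Finset.sum_congr rfl h1, Finset.sum_congr rfl h2, h, h]
  push_cast
  ring

namespace WalkState

variable {w : ℤ → ℝ}

lemma Valid.sum_visits_le {c : WalkState} (h : c.Valid) (M : ℕ) :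
    ∑ k ∈ Finset.Icc (-(M : ℤ)) M, c.visits k ≤ c.t := by
  rw [← h.sum_visits (max M c.t) (le_max_right _ _)]
  refine Finset.sum_le_sum_of_subset (Finset.Icc_subset_Icc ?_ ?_) <;> push_cast <;> omega

lemma ValidUntil.t_le {r n : ℕ} {c : WalkState} (h : c.ValidUntil r) (hn : c.t ≤ n) :
    c.t ≤ 2 * r + 1 + 2 * ∑ i ∈ Finset.range n, c.U (i + 1) +
      2 * ∑ i ∈ Finset.range (n + 1), c.D (-i) := by
  have h0 := h.D_one_le
  have h1 : ∑ i ∈ Finset.range n, c.D (i + 1) ≤ r + ∑ i ∈ Finset.range n, c.U (i + 1) := by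
    cases n with
    | zero => simp
    | succ n =>
      rw [Finset.sum_range_succ', Finset.sum_range_succ _ n]
      have h2 : ∑ i ∈ Finset.range n, c.D (((i + 1 : ℕ) : ℤ) + 1) ≤
          ∑ i ∈ Finset.range n, c.U (i + 1) := Finset.sum_le_sum fun i _ => by
        have h3 := h.valid.flow (i + 1)
        push_cast
        split_ifs at h3 <;> omega
      simp only [Nat.cast_zero, zero_add]
      omega
  have h2 : ∑ i ∈ Finset.range (n + 1), c.U (-i) ≤
      r + 1 + ∑ i ∈ Finset.range (n + 1), c.D (-i) := by
    rw [Finset.sum_range_succ', Finset.sum_range_succ _ n]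
    have h2 : ∑ i ∈ Finset.range n, c.U (-((i + 1 : ℕ) : ℤ)) ≤
        ∑ i ∈ Finset.range n, c.D (-i) := Finset.sum_le_sum fun i _ => by
      have h3 := h.valid.flow (-((i + 1 : ℕ) : ℤ))
      rw [show -((i + 1 : ℕ) : ℤ) + 1 = -(i : ℤ) by push_cast; ring] at h3
      split_ifs at h3 <;> omega
    have h4 := h.valid.flow 0
    simp only [Nat.cast_zero, neg_zero]
    simp only [zero_add] at h4
    split_ifs at h4 <;> omega
  have h3 := h.valid.sum_visits n hn
  simp only [visits, Finset.sum_add_distrib] at h3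
  rw [sum_Icc_neg, sum_Icc_neg] at h3
  omega

open Classical in
/-- Indicator of the states that have not been stopped yet. -/
def running (r : ℕ) (c : WalkState) : ℝ≥0∞ := if c ∈ returned r then 0 else 1

/-- The amount by which `v` falls short of the typical number of steps from `k` in one direction
at the `r`-th return. -/
def shortfall (r : ℕ) (k : ℤ) (v : ℕ) : ℝ≥0∞ :=
  ENNReal.ofReal (max ((r : ℝ) - |(k : ℝ)| / 2 - 1 / 2 - v) 0)

open Classical in
/-- Total shortfall at the site `k` of a stopped state. -/
def deficit (r : ℕ) (k : ℤ) (c : WalkState) : ℝ≥0∞ :=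
  if c ∈ returned r then shortfall r k (c.U k) + shortfall r k (c.D k) else 0

lemma expect_time_le (h : GoodWeight w) {ε : ℝ} (hε : 0 < ε) :
    ∃ r₀ : ℕ, ∀ r ≥ r₀, ∀ n, expect w (returned r) n init (fun c => (c.t : ℝ≥0∞)) ≤
      ENNReal.ofReal (2 * r + 1 + 4 * (1 + ε) * r ^ 2) := by
  obtain ⟨C, hK⟩ := exists_criticalKernel_upLaw h
  obtain ⟨r₀, hr₀⟩ := hK.sum_iterate_id_le hε
  refine ⟨r₀, fun r hr n => ?_⟩
  set P := kerOp fun d j => upLaw w d 0 j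
  have hmono : Monotone fun u : ℕ => (u : ℝ≥0∞) := Nat.mono_cast
  have h1 : expect w (returned r) n init (fun c => (c.t : ℝ≥0∞)) ≤
      expect w (returned r) n init (fun c => (((2 * r + 1 : ℕ) : ℝ≥0∞) +
        2 * ∑ i ∈ Finset.range n, (c.U (i + 1) : ℝ≥0∞)) +
        2 * ∑ i ∈ Finset.range (n + 1), (c.D (-i) : ℝ≥0∞)) := by
    refine expect_mono (I := ValidUntil r) ValidUntil.up_dn (validUntil_init r)
      fun c hc ht _ => ?_
    have := hc.t_le (n := n) (by simpa [init] using ht)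
    exact_mod_cast this
  refine h1.trans ?_
  rw [expect_add, expect_add, expect_const h.1, expect_const_mul, expect_const_mul, expect_sum,
    expect_sum]
  have h2 : ∑ i ∈ Finset.range (n + 1), P^[i + 1] (fun u => (u : ℝ≥0∞)) r ≤
      ENNReal.ofReal ((1 + ε) * r ^ 2) := by
    refine le_trans ?_ (hr₀ r hr (n + 2))
    rw [Finset.sum_range_succ' _ (n + 1)]
    exact le_self_add
  have h3 : ∑ i ∈ Finset.range n, P^[i + 1] (fun u => (u : ℝ≥0∞)) r ≤
      ENNReal.ofReal ((1 + ε) * r ^ 2) :=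
    (Finset.sum_le_sum_of_subset (Finset.range_mono (Nat.le_succ n))).trans h2
  have h4 := (Finset.sum_le_sum fun i (_ : i ∈ Finset.range n) =>
    expect_U_le h.1 h.monotone hmono r i n).trans h3
  have h5 := (Finset.sum_le_sum fun i (_ : i ∈ Finset.range (n + 1)) =>
    expect_D_le h.1 h.monotone hmono r i n).trans h2
  refine (add_le_add (add_le_add le_rfl (mul_le_mul_right h4 2)) (mul_le_mul_right h5 2)).trans
    (le_of_eq ?_)
  rw [← ENNReal.ofReal_natCast, show (2 : ℝ≥0∞) = ENNReal.ofReal 2 by simp,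
    ← ENNReal.ofReal_mul (by norm_num), ← ENNReal.ofReal_add (by positivity) (by positivity),
    ← ENNReal.ofReal_add (by positivity) (by positivity)]
  congr 1
  push_cast
  ring

lemma shortfall_of_le {r : ℕ} {k : ℤ} {v : ℕ} (h : r ≤ v) : shortfall r k v = 0 := by
  have h1 : (r : ℝ) ≤ v := by exact_mod_cast h
  have h2 := abs_nonneg (k : ℝ)
  rw [shortfall, max_eq_right (by linarith), ENNReal.ofReal_zero]

lemma shortfall_le {r : ℕ} {k : ℤ} {j : ℕ} (h : (j : ℝ) ≤ |(k : ℝ)| + 1) (v : ℕ) :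
    shortfall r k v ≤ ENNReal.ofReal (max ((r : ℝ) - j / 2 - v) 0) :=
  ENNReal.ofReal_le_ofReal (max_le_max (by linarith) le_rfl)

lemma expect_deficit_le (h : GoodWeight w) {ε : ℝ} (hε : 0 < ε) :
    ∃ r₀ : ℕ, ∀ r ≥ r₀, ∀ (k : ℤ) (n : ℕ), expect w (returned r) n init (deficit r k) ≤
      ENNReal.ofReal (2 * ε * r) := by
  classical
  obtain ⟨C, hK⟩ := exists_criticalKernel_upLaw h
  obtain ⟨r₀, hr₀⟩ := hK.iterate_deficit_le hε
  refine ⟨r₀, fun r hr k n => ?_⟩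
  -- it suffices to compare each half of the deficit with one of the nested expectations
  have hU : ∀ (k : ℤ) (K : ℕ), (((K + 1 : ℕ) : ℝ) ≤ |(k : ℝ)| + 1) →
      expect w (returned r) n init
        (fun c => if c ∈ returned r then shortfall r k (c.U (K + 1)) else 0) ≤
      ENNReal.ofReal (ε * r) := fun k K hk =>
    (expect_returned_U_le h.1 r K n _).trans
      ((iterate_kerOp_mono (fun v => shortfall_le hk v) _ r).trans (hr₀ r hr (K + 1)))
  have hD : ∀ (k : ℤ) (K : ℕ), (((K + 1 : ℕ) : ℝ) ≤ |(k : ℝ)| + 1) →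
      expect w (returned r) n init
        (fun c => if c ∈ returned r then shortfall r k (c.D (-K)) else 0) ≤
      ENNReal.ofReal (ε * r) := fun k K hk =>
    (expect_returned_D_le h.1 r K n _).trans
      ((iterate_kerOp_mono (fun v => shortfall_le hk v) _ r).trans (hr₀ r hr (K + 1)))
  have hcongr : ∀ f g : WalkState → ℝ≥0∞, (∀ c, ValidUntil r c → c ∈ returned r → f c ≤ g c) →
      expect w (returned r) n init (fun c => if c ∈ returned r then f c else 0) ≤
      expect w (returned r) n init (fun c => if c ∈ returned r then g c else 0) := by
    intro f g hfg
    refine expect_mono (I := ValidUntil r) ValidUntil.up_dn (validUntil_init r)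
      fun c hc _ _ => ?_
    split_ifs with hS
    · exact hfg c hc hS
    · exact le_rfl
  have hzero : expect w (returned r) n init (fun c => if c ∈ returned r then 0 else 0) ≤
      ENNReal.ofReal (ε * r) := by
    simp only [ite_self, expect_const h.1]
    exact zero_le
  have h1 : expect w (returned r) n init
      (fun c => if c ∈ returned r then shortfall r k (c.U k) else 0) ≤ ENNReal.ofReal (ε * r) := by
    rcases lt_trichotomy k 0 with hk | rfl | hk
    · obtain ⟨i, hi⟩ : ∃ i : ℕ, k = -(i : ℤ) - 1 := ⟨(-k - 1).toNat, by omega⟩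
      refine (hcongr _ (fun c => shortfall r k (c.D (-i))) fun c hc hS => ?_).trans (hD k i ?_)
      · rw [hc.U_eq hS, show k + 1 = -(i : ℤ) by omega]
      · rw [hi]; push_cast; rw [abs_of_nonpos (by linarith [(Nat.cast_nonneg i : (0 : ℝ) ≤ i)])]
        linarith
    · refine (hcongr _ (fun _ => 0) fun c hc hS => ?_).trans hzero
      rw [hc.U_eq hS, zero_add, shortfall_of_le (hc.D_one_eq hS).ge]
    · obtain ⟨i, hi⟩ : ∃ i : ℕ, k = (i : ℤ) + 1 := ⟨(k - 1).toNat, by omega⟩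
      refine (hcongr _ (fun c => shortfall r k (c.U (i + 1))) fun c hc hS => ?_).trans (hU k i ?_)
      · rw [hi]
      · rw [hi]; push_cast; rw [abs_of_nonneg (by positivity)]; linarith
  have h2 : expect w (returned r) n init
      (fun c => if c ∈ returned r then shortfall r k (c.D k) else 0) ≤ ENNReal.ofReal (ε * r) := by
    rcases lt_trichotomy k 1 with hk | rfl | hk
    · obtain ⟨i, hi⟩ : ∃ i : ℕ, k = -(i : ℤ) := ⟨(-k).toNat, by omega⟩
      refine (hcongr _ (fun c => shortfall r k (c.D (-i))) fun c hc hS => ?_).trans (hD k i ?_)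
      · rw [hi]
      · rw [hi]; push_cast; rw [abs_neg, abs_of_nonneg (by positivity)]
    · refine (hcongr _ (fun _ => 0) fun c hc hS => ?_).trans hzero
      rw [shortfall_of_le (hc.D_one_eq hS).ge]
    · obtain ⟨i, hi⟩ : ∃ i : ℕ, k = (i : ℤ) + 2 := ⟨(k - 2).toNat, by omega⟩
      refine (hcongr _ (fun c => shortfall r k (c.U (i + 1))) fun c hc hS => ?_).trans (hU k i ?_)
      · rw [hc.U_eq hS, show (i : ℤ) + 1 + 1 = k by omega]
      · rw [hi]; push_cast; rw [abs_of_nonneg (by positivity)]; linarith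
  have h3 : deficit r k = fun c => (if c ∈ returned r then shortfall r k (c.U k) else 0) +
      if c ∈ returned r then shortfall r k (c.D k) else 0 := by
    funext c
    simp only [deficit]
    split_ifs
    · rfl
    · rw [add_zero]
  rw [h3, expect_add]
  refine (add_le_add h1 h2).trans_eq ?_
  rw [← ENNReal.ofReal_add (by positivity) (by positivity)]
  congr 1
  ring

lemma ofReal_le_visits_add (r : ℕ) (k : ℤ) (c : WalkState) :
    ENNReal.ofReal (2 * r - |(k : ℝ)| - 1) ≤
      c.visits k + ENNReal.ofReal (2 * r) * running r c + deficit r k c := by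
  by_cases hS : c ∈ returned r
  · rw [running, deficit, if_pos hS, if_pos hS, mul_zero, add_zero, shortfall, shortfall,
      ← ENNReal.ofReal_natCast, ← ENNReal.ofReal_add (le_max_right _ _) (le_max_right _ _),
      ← ENNReal.ofReal_add (by positivity) (add_nonneg (le_max_right _ _) (le_max_right _ _))]
    refine ENNReal.ofReal_le_ofReal ?_
    have h1 := le_max_left ((r : ℝ) - |(k : ℝ)| / 2 - 1 / 2 - c.U k) 0
    have h2 := le_max_left ((r : ℝ) - |(k : ℝ)| / 2 - 1 / 2 - c.D k) 0
    simp only [visits]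
    push_cast
    linarith
  · rw [running, if_neg hS, mul_one]
    refine le_trans (ENNReal.ofReal_le_ofReal ?_) (le_self_add.trans'
      (self_le_add_left _ _))
    have := abs_nonneg (k : ℝ)
    linarith

lemma ofReal_le_time_add {r n : ℕ} (hr : 2 ≤ r) (hn : 4 * r ^ 2 ≤ n) {c : WalkState}
    (hc : c.ValidUntil r) (ht : c ∈ returned r ∨ c.t = n) :
    ENNReal.ofReal (n - (4 * r ^ 2 - 4 * r - 1)) * running r c +
        ENNReal.ofReal (4 * r ^ 2 - 4 * r - 1) ≤
      c.t + ∑ k ∈ Finset.Icc (-((2 * r : ℕ) : ℤ)) ((2 * r : ℕ) : ℤ), deficit r k c := by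
  have hr' : (2 : ℝ) ≤ r := by exact_mod_cast hr
  have hn' : 4 * (r : ℝ) ^ 2 ≤ n := by exact_mod_cast hn
  by_cases hS : c ∈ returned r
  · have h1 := hc.valid.sum_visits_le (2 * r)
    have h2 : ∑ k ∈ Finset.Icc (-((2 * r : ℕ) : ℤ)) ((2 * r : ℕ) : ℤ),
        ((2 * r : ℕ) - |(k : ℝ)| - 1 : ℝ) = 4 * r ^ 2 - 4 * r - 1 := by
      rw [Finset.sum_sub_distrib, sum_Icc_neg_sub_abs]
      simp only [Finset.sum_const, Int.card_Icc, nsmul_eq_mul, mul_one]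
      rw [show (((2 * r : ℕ) : ℤ) + 1 - -((2 * r : ℕ) : ℤ)).toNat = 4 * r + 1 by omega]
      push_cast
      ring
    rw [running, if_pos hS, mul_zero, zero_add, ← h2]
    refine (ofReal_sum_le_sum_ofReal _ _).trans ?_
    calc ∑ k ∈ Finset.Icc (-((2 * r : ℕ) : ℤ)) ((2 * r : ℕ) : ℤ),
          ENNReal.ofReal ((2 * r : ℕ) - |(k : ℝ)| - 1)
        ≤ ∑ k ∈ Finset.Icc (-((2 * r : ℕ) : ℤ)) ((2 * r : ℕ) : ℤ),
          ((c.visits k : ℝ≥0∞) + deficit r k c) := by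
          refine Finset.sum_le_sum fun k _ => ?_
          have h3 := ofReal_le_visits_add r k c
          rw [running, if_pos hS, mul_zero, add_zero] at h3
          push_cast
          exact h3
      _ ≤ _ := by
          rw [Finset.sum_add_distrib]
          gcongr
          exact_mod_cast h1
  · have h1 : c.t = n := ht.resolve_left hS
    rw [running, if_neg hS, mul_one, ← ENNReal.ofReal_add (by linarith) (by nlinarith), h1,
      sub_add_cancel, ENNReal.ofReal_natCast]
    exact le_self_add

end WalkState

namespace WalkState

variable {w : ℤ → ℝ}

/-- It is unlikely that the `r`-th return has not happened at time `4 (1 + ε / 4)² r²`. -/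
lemma expect_running_le (h : GoodWeight w) {ε : ℝ} (hε : 0 < ε) (hε1 : ε ≤ 1) :
    ∃ r₀ : ℕ, ∀ r ≥ r₀, ∀ n : ℕ, 4 * (1 + ε / 4) ^ 2 * (r : ℝ) ^ 2 ≤ n →
      expect w (returned r) n init (running r) ≤ ENNReal.ofReal (ε / 4) := by
  have hε' : 0 < ε ^ 2 / 48 := by positivity
  obtain ⟨r₁, hr₁⟩ := expect_time_le h hε'
  obtain ⟨r₂, hr₂⟩ := expect_deficit_le h hε'
  refine ⟨max (max r₁ r₂) (max 2 ⌈36 / ε ^ 2⌉₊), fun r hr n hn => ?_⟩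
  simp only [ge_iff_le, max_le_iff] at hr
  obtain ⟨⟨hr1, hr2⟩, hr3, hr4⟩ := hr
  have hr3' : (2 : ℝ) ≤ r := by exact_mod_cast hr3
  have hr4' : 36 ≤ ε ^ 2 * r := by
    have := Nat.ceil_le.1 hr4
    rw [div_le_iff₀ (by positivity)] at this
    linarith
  have hn1 : 4 * (r : ℝ) ^ 2 + 2 * ε * (r : ℝ) ^ 2 ≤ n := by
    have : 0 ≤ ε ^ 2 * (r : ℝ) ^ 2 := by positivity
    nlinarith
  have hn2 : 4 * r ^ 2 ≤ n := by
    have : 0 ≤ 2 * ε * (r : ℝ) ^ 2 := by positivity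
    have h1 : 4 * (r : ℝ) ^ 2 ≤ n := by linarith
    exact_mod_cast h1
  set p := expect w (returned r) n init (running r) with hp
  have hp1 : p ≤ 1 := by
    rw [← expect_const h.1 (S := returned r) 1 n init]
    refine expect_mono (I := fun _ => True) (fun _ _ _ => ⟨trivial, trivial⟩) trivial
      fun c _ _ _ => ?_
    unfold running
    split_ifs
    · exact zero_le_one
    · exact le_rfl
  have hpt : p ≠ ⊤ := ne_top_of_le_ne_top ENNReal.one_ne_top hp1
  have h1 : expect w (returned r) n init (fun c =>
        ENNReal.ofReal (n - (4 * r ^ 2 - 4 * r - 1)) * running r c +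
          ENNReal.ofReal (4 * r ^ 2 - 4 * r - 1)) ≤
      expect w (returned r) n init (fun c => (c.t : ℝ≥0∞) +
        ∑ k ∈ Finset.Icc (-((2 * r : ℕ) : ℤ)) ((2 * r : ℕ) : ℤ), deficit r k c) := by
    refine expect_mono (I := ValidUntil r) ValidUntil.up_dn (validUntil_init r)
      fun c hc _ ht => ofReal_le_time_add hr3 hn2 hc (ht.imp_right fun h => ?_)
    simpa [init] using h
  rw [expect_add, expect_add, expect_const h.1, expect_const_mul, expect_sum, ← hp] at h1
  have h2 := h1.trans (add_le_add (hr₁ r hr1 n) (Finset.sum_le_sum fun k _ => hr₂ r hr2 k n))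
  rw [Finset.sum_const, Int.card_Icc,
    show (((2 * r : ℕ) : ℤ) + 1 - -((2 * r : ℕ) : ℤ)).toNat = 4 * r + 1 by omega, nsmul_eq_mul,
    ← ENNReal.ofReal_natCast (4 * r + 1), ← ENNReal.ofReal_mul (by positivity),
    ← ENNReal.ofReal_add (by positivity) (by positivity), ← ENNReal.ofReal_toReal hpt,
    ← ENNReal.ofReal_mul (by nlinarith), ← ENNReal.ofReal_add
      (mul_nonneg (by nlinarith) ENNReal.toReal_nonneg) (by nlinarith),
    ENNReal.ofReal_le_ofReal_iff (by positivity)] at h2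
  rw [← ENNReal.ofReal_toReal hpt]
  refine ENNReal.ofReal_le_ofReal ?_
  by_contra! hcon
  have h3 : 2 * ε * (r : ℝ) ^ 2 * (ε / 4) <
      (n - (4 * (r : ℝ) ^ 2 - 4 * r - 1)) * p.toReal := by
    refine mul_lt_mul'' (by linarith) hcon (by positivity) (by positivity)
  have h4 : 36 * (r : ℝ) ≤ ε ^ 2 * r * r := by gcongr
  have h5 : ε ^ 2 * r ≤ r := mul_le_of_le_one_left (by positivity) (by nlinarith)
  push_cast at h2
  nlinarith

/-- Lower bound for the expected occupation times of the walk. -/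
lemma le_sum_expect_pos (h : GoodWeight w) {ε : ℝ} (hε : 0 < ε) :
    ∃ n₀ : ℕ, ∀ n ≥ n₀, ∀ k : ℤ,
      ENNReal.ofReal (√n - |(k : ℝ)| - ε * √n) ≤
        ∑ j ∈ Finset.range n, expect w ∅ j init (fun c => if c.pos = k then 1 else 0) := by
  wlog hε1 : ε ≤ 1 generalizing ε
  · obtain ⟨n₀, hn₀⟩ := this one_pos le_rfl
    refine ⟨n₀, fun n hn k => (ENNReal.ofReal_le_ofReal ?_).trans (hn₀ n hn k)⟩
    have := Real.sqrt_nonneg n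
    nlinarith
  obtain ⟨r₁, hr₁⟩ := expect_running_le h hε hε1
  obtain ⟨r₂, hr₂⟩ := expect_deficit_le h (show 0 < ε ^ 2 / 48 by positivity)
  have hsqrt : Tendsto (fun n : ℕ => √(n : ℝ)) atTop atTop :=
    Real.tendsto_sqrt_atTop.comp tendsto_natCast_atTop_atTop
  have hfloor : Tendsto (fun n : ℕ => ⌊√(n : ℝ) / (2 * (1 + ε / 4))⌋₊) atTop atTop :=
    tendsto_nat_floor_atTop.comp (hsqrt.atTop_div_const (by positivity))
  obtain ⟨n₀, hn₀⟩ := eventually_atTop.1 ((hfloor.eventually_ge_atTop (max r₁ r₂)).and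
    (hsqrt.eventually_ge_atTop (8 / ε)))
  refine ⟨n₀, fun n hn k => ?_⟩
  obtain ⟨hr, hn1⟩ := hn₀ n hn
  set r := ⌊√(n : ℝ) / (2 * (1 + ε / 4))⌋₊ with hrdef
  rw [max_le_iff] at hr
  rw [div_le_iff₀ hε] at hn1
  have hr3 : 2 * (1 + ε / 4) * r ≤ √n := by
    have := Nat.floor_le (show 0 ≤ √(n : ℝ) / (2 * (1 + ε / 4)) by positivity)
    rw [← hrdef, le_div_iff₀ (by positivity)] at this
    linarith
  have hr4 : √n ≤ 2 * (1 + ε / 4) * (r + 1) := by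
    have := Nat.lt_floor_add_one (√(n : ℝ) / (2 * (1 + ε / 4)))
    rw [← hrdef, div_lt_iff₀ (by positivity)] at this
    linarith
  have hn2 : 4 * (1 + ε / 4) ^ 2 * (r : ℝ) ^ 2 ≤ n := by
    calc 4 * (1 + ε / 4) ^ 2 * (r : ℝ) ^ 2 = (2 * (1 + ε / 4) * r) ^ 2 := by ring
      _ ≤ √n ^ 2 := by gcongr
      _ = n := Real.sq_sqrt (Nat.cast_nonneg n)
  have h1 : expect w (returned r) n init (fun _ => ENNReal.ofReal (2 * r - |(k : ℝ)| - 1)) ≤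
      expect w (returned r) n init (fun c =>
        (c.visits k + ENNReal.ofReal (2 * r) * running r c) + deficit r k c) :=
    expect_mono (I := fun _ => True) (fun _ _ _ => ⟨trivial, trivial⟩) trivial
      fun c _ _ _ => ofReal_le_visits_add r k c
  rw [expect_const h.1, expect_add, expect_add, expect_const_mul] at h1
  have h2 : expect w (returned r) n init (fun c => (c.visits k : ℝ≥0∞)) ≤
      ∑ j ∈ Finset.range n, expect w ∅ j init (fun c => if c.pos = k then 1 else 0) := by
    rw [← expect_visits h.1]
    refine expect_le_expect_empty h.1 (fun c => ?_) n init
    rw [visits_up, visits_dn]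
    exact ⟨by exact_mod_cast Nat.le_add_right _ _, by exact_mod_cast Nat.le_add_right _ _⟩
  have h3 := h1.trans (add_le_add (add_le_add h2 (mul_le_mul_right (hr₁ r hr.1 n hn2) _))
    (hr₂ r hr.2 k n))
  rw [← ENNReal.ofReal_mul (by positivity), add_assoc,
    ← ENNReal.ofReal_add (by positivity) (by positivity), ← tsub_le_iff_right,
    ← ENNReal.ofReal_sub _ (by positivity)] at h3
  refine (ENNReal.ofReal_le_ofReal ?_).trans h3
  have hr5 : 0 ≤ ε * r := by positivity
  have hr6 : ε ^ 2 * r ≤ ε * r := by nlinarith [(Nat.cast_nonneg r : (0 : ℝ) ≤ r)]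
  nlinarith

end WalkState

namespace WalkState

/-- The state reached by the path `x` at time `n`. -/
def ofPath (x : ℕ → ℤ) (n : ℕ) : WalkState := ⟨x n, dirLocP x n, dirLocM x n, n⟩

lemma ofPath_zero {x : ℕ → ℤ} (h : x 0 = 0) : ofPath x 0 = init := by
  simp only [ofPath, init, h, mk.injEq, true_and, and_true]
  constructor <;> funext k <;> simp [dirLocP, dirLocM]

lemma ofPath_congr {x y : ℕ → ℤ} {n : ℕ} (h : ∀ i ≤ n, x i = y i) : ofPath x n = ofPath y n := by
  simp only [ofPath, mk.injEq, and_true]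
  refine ⟨h n le_rfl, ?_, ?_⟩ <;> funext k <;> simp only [dirLocP, dirLocM] <;>
    refine congrArg _ (Finset.filter_congr fun j hj => ?_) <;>
    rw [Finset.mem_range] at hj <;> rw [h j (by omega), h (j + 1) (by omega)]

lemma ofPath_succ_of_eq_add_one {x : ℕ → ℤ} {n : ℕ} (h : x (n + 1) = x n + 1) :
    ofPath x (n + 1) = (ofPath x n).up := by
  simp only [ofPath, up, mk.injEq, and_true]
  refine ⟨h, ?_, ?_⟩ <;> funext k
  · rcases eq_or_ne k (x n) with rfl | hk
    · simp [dirLocP, Finset.range_add_one, Finset.filter_insert, h]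
    · simp [dirLocP, Finset.range_add_one, Finset.filter_insert, hk, hk.symm]
  · have : ¬ (x n = k ∧ x n + 1 = k - 1) := by omega
    simp only [dirLocM, Finset.range_add_one, Finset.filter_insert, h, if_neg this]

lemma ofPath_succ_of_eq_sub_one {x : ℕ → ℤ} {n : ℕ} (h : x (n + 1) = x n - 1) :
    ofPath x (n + 1) = (ofPath x n).dn := by
  simp only [ofPath, dn, mk.injEq, and_true]
  refine ⟨h, ?_, ?_⟩ <;> funext k
  · have : ¬ (x n = k ∧ x n - 1 = k + 1) := by omega
    simp only [dirLocP, Finset.range_add_one, Finset.filter_insert, h, if_neg this]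
  · rcases eq_or_ne k (x n) with rfl | hk
    · simp [dirLocM, Finset.range_add_one, Finset.filter_insert, h]
    · simp [dirLocM, Finset.range_add_one, Finset.filter_insert, hk, hk.symm]

end WalkState

lemma stepProb_of_eq_add_one (w : ℤ → ℝ) {x : ℕ → ℤ} {n : ℕ} (h : x (n + 1) = x n + 1) :
    stepProb w x n = upProb w (WalkState.ofPath x n).drift := by
  simp only [stepProb, if_pos h]
  rfl

lemma stepProb_of_eq_sub_one (w : ℤ → ℝ) {x : ℕ → ℤ} {n : ℕ} (h : x (n + 1) = x n - 1) :
    stepProb w x n = downProb w (WalkState.ofPath x n).drift := by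
  have h' : ¬ x (n + 1) = x n + 1 := by omega
  simp only [stepProb, if_neg h', if_pos h]
  rfl

lemma stepProb_of_ne (w : ℤ → ℝ) {x : ℕ → ℤ} {n : ℕ} (h : x (n + 1) ≠ x n + 1)
    (h' : x (n + 1) ≠ x n - 1) : stepProb w x n = 0 := by
  simp only [stepProb, if_neg h, if_neg h']

section Marginals

variable {Ω : Type*} [MeasurableSpace Ω] {μ : Measure Ω} {w : ℤ → ℝ} {X : ℕ → Ω → ℤ}

open WalkState in
lemma IsSRW.measure_cylinder_inter (hX : IsSRW μ w X) (z : ℤ) (k m : ℕ) (x : ℕ → ℤ) :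
    μ ({ω | ∀ i ≤ m, X i ω = x i} ∩ {ω | X (m + k) ω = z}) =
      μ {ω | ∀ i ≤ m, X i ω = x i} *
        expect w ∅ k (ofPath x m) (fun c => if c.pos = z then 1 else 0) := by
  induction k generalizing m x with
  | zero =>
    rw [add_zero, expect, show (ofPath x m).pos = x m from rfl]
    by_cases h : x m = z
    · rw [if_pos h, mul_one]
      congr 1
      ext ω
      simp only [Set.mem_inter_iff, Set.mem_ofPred_eq, and_iff_left_iff_imp]
      intro h1
      rw [h1 m le_rfl, h]
    · rw [if_neg h, mul_zero]
      convert measure_empty (μ := μ)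
      ext ω
      simp only [Set.mem_inter_iff, Set.mem_ofPred_eq, Set.mem_empty_iff_false, iff_false, not_and]
      intro h1 h2
      exact h (by rw [← h1 m le_rfl, h2])
  | succ k ih =>
    set y : ℤ → ℕ → ℤ := fun j => Function.update x (m + 1) j with hy
    have hyx : ∀ j, ∀ i ≤ m, y j i = x i := fun j i hi =>
      Function.update_of_ne (by omega) _ _
    have hyj : ∀ j, y j (m + 1) = j := fun j => Function.update_self _ _ _
    have hcyl : ∀ j, {ω | ∀ i ≤ m, X i ω = y j i} = {ω | ∀ i ≤ m, X i ω = x i} := by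
      intro j
      ext ω
      exact forall₂_congr fun i hi => by rw [hyx j i hi]
    have hsplit : ∀ j, ({ω | ∀ i ≤ m, X i ω = x i} ∩ {ω | X (m + (k + 1)) ω = z}) ∩
        X (m + 1) ⁻¹' {j} =
        {ω | ∀ i ≤ m + 1, X i ω = y j i} ∩ {ω | X (m + 1 + k) ω = z} := by
      intro j
      ext ω
      rw [show m + (k + 1) = m + 1 + k by omega]
      have h1 : (∀ i ≤ m + 1, X i ω = y j i) ↔ (∀ i ≤ m, X i ω = x i) ∧ X (m + 1) ω = j := by
        simp only [Nat.le_succ_iff, or_imp, forall_and, forall_eq, hyj]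
        exact and_congr_left' (forall₂_congr fun i hi => by rw [hyx j i hi])
      simp only [Set.mem_inter_iff, Set.mem_ofPred_eq, Set.mem_preimage, Set.mem_singleton_iff, h1]
      tauto
    have hsum : ∑' j, μ ({ω | ∀ i ≤ m + 1, X i ω = y j i} ∩ {ω | X (m + 1 + k) ω = z}) =
        μ ({ω | ∀ i ≤ m, X i ω = x i} ∩ {ω | X (m + (k + 1)) ω = z}) := by
      simp only [← hsplit]
      rw [← measure_iUnion, ← Set.inter_iUnion, ← Set.preimage_iUnion, Set.iUnion_of_singleton,
        Set.preimage_univ, Set.inter_univ]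
      · intro i j hij
        exact Disjoint.mono Set.inter_subset_right Set.inter_subset_right
          (Disjoint.preimage _ (Set.disjoint_singleton.2 hij))
      · intro j
        refine (MeasurableSet.inter ?_ ?_).inter (hX.1 _ (measurableSet_singleton j))
        · simp only [Set.ofPred_forall]
          exact MeasurableSet.iInter fun i => MeasurableSet.iInter fun _ =>
            hX.1 i (measurableSet_singleton (x i))
        · exact hX.1 _ (measurableSet_singleton z)
    rw [← hsum]
    simp only [ih, hX.2.2 m, hcyl]
    rw [tsum_eq_sum (s := {x m + 1, x m - 1}), Finset.sum_pair (by omega)]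
    · have hu : y (x m + 1) (m + 1) = y (x m + 1) m + 1 := by rw [hyj, hyx _ m le_rfl]
      have hd : y (x m - 1) (m + 1) = y (x m - 1) m - 1 := by rw [hyj, hyx _ m le_rfl]
      rw [stepProb_of_eq_add_one w hu, stepProb_of_eq_sub_one w hd, ofPath_succ_of_eq_add_one hu,
        ofPath_succ_of_eq_sub_one hd, ofPath_congr (hyx _), ofPath_congr (hyx _), expect,
        if_neg (Set.notMem_empty _)]
      ring
    · intro j hj
      simp only [Finset.mem_insert, Finset.mem_singleton, not_or] at hj
      rw [stepProb_of_ne w (by rw [hyj, hyx _ m le_rfl]; exact hj.1)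
        (by rw [hyj, hyx _ m le_rfl]; exact hj.2)]
      simp

/-- The one-time marginals of the walk. -/
lemma IsSRW.measure_eq_expect [IsProbabilityMeasure μ] (hX : IsSRW μ w X) (n : ℕ) (z : ℤ) :
    μ {ω | X n ω = z} =
      WalkState.expect w ∅ n WalkState.init (fun c => if c.pos = z then 1 else 0) := by
  have h := hX.measure_cylinder_inter z n 0 (fun _ => 0)
  have h0 : {ω | ∀ i ≤ 0, X i ω = (fun _ => (0 : ℤ)) i} = {ω | X 0 ω = 0} := by
    ext ω
    simp
  rw [h0, hX.2.1, one_mul, zero_add, WalkState.ofPath_zero (x := fun _ => 0) rfl] at h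
  rw [← h]
  refine (Measure.measure_inter_eq_of_ae ?_).symm
  exact (mem_ae_iff_prob_eq_one (hX.1 0 (measurableSet_singleton 0))).2 hX.2.1

end Marginals

lemma lintegral_exp_Ioi {s : ℝ} (hs : 0 < s) (c : ℝ) :
    ∫⁻ t in Set.Ioi c, ENNReal.ofReal (s * Real.exp (-(s * t))) =
      ENNReal.ofReal (Real.exp (-(s * c))) := by
  have hs' : -s < 0 := by linarith
  simp only [← neg_mul]
  rw [← ofReal_integral_eq_lintegral_ofReal ((integrableOn_exp_mul_Ioi hs' c).const_mul s)
    (ae_of_all _ fun t => by positivity), integral_const_mul, integral_exp_mul_Ioi hs' c]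
  congr 1
  field_simp

lemma lintegral_mul_exp_sq_Ioi {s : ℝ} (hs : 0 < s) :
    ∫⁻ v in Set.Ioi (0 : ℝ), ENNReal.ofReal (2 * s * v * Real.exp (-(s * v ^ 2))) = 1 := by
  have hd : ∀ v ∈ Set.Ici (0 : ℝ), HasDerivAt (fun v : ℝ => -Real.exp (-(s * v ^ 2)))
      (2 * s * v * Real.exp (-(s * v ^ 2))) v := by
    intro v _
    have := (((hasDerivAt_pow 2 v).const_mul s).neg.exp).neg
    refine this.congr_deriv ?_
    simp only [Nat.cast_ofNat, Pi.neg_apply]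
    ring
  have hpos : ∀ v ∈ Set.Ioi (0 : ℝ), 0 ≤ 2 * s * v * Real.exp (-(s * v ^ 2)) := by
    intro v hv
    have : 0 < v := hv
    positivity
  have hlim : Tendsto (fun v : ℝ => -Real.exp (-(s * v ^ 2))) atTop (𝓝 0) := by
    rw [← neg_zero]
    refine (Real.tendsto_exp_neg_atTop_nhds_zero.comp ?_).neg
    exact (tendsto_pow_atTop two_ne_zero).const_mul_atTop hs
  rw [← ofReal_integral_eq_lintegral_ofReal (integrableOn_Ioi_deriv_of_nonneg' hd hpos hlim)
    (ae_restrict_of_forall_mem measurableSet_Ioi hpos),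
    integral_Ioi_of_hasDerivAt_of_nonneg' hd hpos hlim]
  simp

/-- The local time density at an independent exponential time as an integral of the local time
profile `(√t - |y|)₊`. -/
def expDensity (s y : ℝ) : ℝ≥0∞ :=
  ∫⁻ t in Set.Ioi (0 : ℝ), ENNReal.ofReal (s ^ 2 * Real.exp (-(s * t)) * (√t - |y|))

lemma expDensity_eq {s : ℝ} (hs : 0 < s) (y : ℝ) :
    expDensity s y = ∫⁻ v in Set.Ioi |y|, ENNReal.ofReal (s * Real.exp (-(s * v ^ 2))) := by
  have h1 : ∀ t ∈ Set.Ioi (0 : ℝ), ENNReal.ofReal (s ^ 2 * Real.exp (-(s * t)) * (√t - |y|)) =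
      ∫⁻ v in Set.Ioi |y|, (Set.Ioi (v ^ 2)).indicator
        (fun t => ENNReal.ofReal (s ^ 2 * Real.exp (-(s * t)))) t := by
    intro t ht
    have h2 : ∀ v ∈ Set.Ioi |y|, (Set.Ioi (v ^ 2)).indicator
        (fun t => ENNReal.ofReal (s ^ 2 * Real.exp (-(s * t)))) t =
        (Set.Iio √t).indicator (fun _ => ENNReal.ofReal (s ^ 2 * Real.exp (-(s * t)))) v := by
      intro v hv
      have hv' : 0 ≤ v := (abs_nonneg y).trans (le_of_lt hv)
      simp only [Set.indicator, Set.mem_Ioi, Set.mem_Iio, Real.lt_sqrt hv']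
    rw [setLIntegral_congr_fun measurableSet_Ioi h2, lintegral_indicator measurableSet_Iio,
      setLIntegral_const, Measure.restrict_apply measurableSet_Iio, Set.inter_comm,
      Set.Ioi_inter_Iio, Real.volume_Ioo, ENNReal.ofReal_mul (by positivity)]
  rw [expDensity, setLIntegral_congr_fun measurableSet_Ioi h1, lintegral_lintegral_swap]
  · refine setLIntegral_congr_fun measurableSet_Ioi fun v hv => ?_
    rw [lintegral_indicator measurableSet_Ioi, Measure.restrict_restrict measurableSet_Ioi,
      Set.inter_eq_left.2 (Set.Ioi_subset_Ioi (sq_nonneg v))]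
    have h3 : ∀ t : ℝ, ENNReal.ofReal (s ^ 2 * Real.exp (-(s * t))) =
        ENNReal.ofReal s * ENNReal.ofReal (s * Real.exp (-(s * t))) := by
      intro t
      rw [← ENNReal.ofReal_mul hs.le]
      congr 1
      ring
    simp only [h3]
    rw [lintegral_const_mul _ (by fun_prop), lintegral_exp_Ioi hs, ← ENNReal.ofReal_mul hs.le]
  · refine Measurable.aemeasurable ?_
    have h4 : (Function.uncurry fun t v : ℝ => (Set.Ioi (v ^ 2)).indicator
        (fun t => ENNReal.ofReal (s ^ 2 * Real.exp (-(s * t)))) t) =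
        {p : ℝ × ℝ | p.2 ^ 2 < p.1}.indicator
          fun p => ENNReal.ofReal (s ^ 2 * Real.exp (-(s * p.1))) := by
      funext p
      simp [Function.uncurry, Set.indicator]
    rw [h4]
    exact Measurable.indicator (by fun_prop) (measurableSet_lt (by fun_prop) (by fun_prop))

lemma lintegral_expDensity {s : ℝ} (hs : 0 < s) : ∫⁻ y, expDensity s y = 1 := by
  have h1 : ∀ y, expDensity s y = ∫⁻ v in Set.Ioi (0 : ℝ), (Set.Ioo (-v) v).indicator
      (fun _ => ENNReal.ofReal (s * Real.exp (-(s * v ^ 2)))) y := by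
    intro y
    have h2 : ∀ v, (Set.Ioo (-v) v).indicator
        (fun _ => ENNReal.ofReal (s * Real.exp (-(s * v ^ 2)))) y = (Set.Ioi |y|).indicator
        (fun v => ENNReal.ofReal (s * Real.exp (-(s * v ^ 2)))) v := by
      intro v
      simp only [Set.indicator, Set.mem_Ioo, Set.mem_Ioi, abs_lt]
    simp only [h2]
    rw [expDensity_eq hs, lintegral_indicator measurableSet_Ioi,
      Measure.restrict_restrict measurableSet_Ioi,
      Set.inter_eq_left.2 (Set.Ioi_subset_Ioi (abs_nonneg y))]
  simp only [h1]
  rw [lintegral_lintegral_swap, ← lintegral_mul_exp_sq_Ioi hs]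
  · refine setLIntegral_congr_fun measurableSet_Ioi fun v hv => ?_
    rw [lintegral_indicator measurableSet_Ioo, setLIntegral_const, Real.volume_Ioo,
      ← ENNReal.ofReal_mul (by positivity)]
    congr 1
    ring
  · refine Measurable.aemeasurable ?_
    have h4 : (Function.uncurry fun y v : ℝ => (Set.Ioo (-v) v).indicator
        (fun _ => ENNReal.ofReal (s * Real.exp (-(s * v ^ 2)))) y) =
        {p : ℝ × ℝ | |p.1| < p.2}.indicator
          fun p => ENNReal.ofReal (s * Real.exp (-(s * p.2 ^ 2))) := by
      funext p
      simp [Function.uncurry, Set.indicator, abs_lt]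
    rw [h4]
    exact Measurable.indicator (by fun_prop) (measurableSet_lt (by fun_prop) (by fun_prop))

lemma one_sub_stdNormalCdf (x : ℝ) :
    1 - stdNormalCdf x = (√(2 * Real.pi))⁻¹ * ∫ y in Set.Ioi x, Real.exp (-(y ^ 2) / 2) := by
  have h1 : (fun y : ℝ => Real.exp (-(y ^ 2) / 2)) = fun y => Real.exp (-(1 / 2) * y ^ 2) := by
    funext y
    congr 1
    ring
  have h2 : Integrable fun y : ℝ => Real.exp (-(y ^ 2) / 2) := by
    rw [h1]
    exact integrable_exp_neg_mul_sq (by norm_num)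
  have h3 : ∫ y : ℝ, Real.exp (-(y ^ 2) / 2) = √(2 * Real.pi) := by
    rw [h1, integral_gaussian]
    congr 1
    ring
  have h4 := intervalIntegral.integral_Iic_add_Ioi (b := x) h2.integrableOn h2.integrableOn
  have h5 : √(2 * Real.pi) ≠ 0 := by positivity
  rw [h3] at h4
  rw [stdNormalCdf, eq_sub_of_add_eq' h4]
  field_simp

lemma expDensity_eq_phiHat {s : ℝ} (hs : 0 < s) (y : ℝ) :
    expDensity s y = ENNReal.ofReal (phiHat s y) := by
  have h1 : (fun v : ℝ => s * Real.exp (-(s * v ^ 2))) =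
      fun v => s * (fun u => Real.exp (-(u ^ 2) / 2)) (√(2 * s) * v) := by
    funext v
    simp only [mul_pow]
    rw [Real.sq_sqrt (by positivity)]
    congr 2
    ring
  have h2 : Integrable fun v : ℝ => s * Real.exp (-(s * v ^ 2)) := by
    simp only [← neg_mul]
    exact (integrable_exp_neg_mul_sq hs).const_mul s
  rw [expDensity_eq hs, ← ofReal_integral_eq_lintegral_ofReal h2.integrableOn
    (ae_of_all _ fun v => by positivity), h1, integral_const_mul,
    integral_comp_mul_left_Ioi (fun u => Real.exp (-(u ^ 2) / 2)) _ (by positivity), phiHat,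
    one_sub_stdNormalCdf, smul_eq_mul]
  congr 1
  rw [← mul_assoc, ← mul_assoc]
  congr 1
  rw [← div_eq_mul_inv, ← div_eq_mul_inv, div_eq_div_iff (by positivity) (by positivity)]
  rw [← Real.sqrt_mul (by positivity), show s * Real.pi * (2 * s) = s ^ 2 * (2 * Real.pi) by ring,
    Real.sqrt_mul (sq_nonneg s), Real.sqrt_sq hs.le]

/-- Average of `f` with respect to the geometric distribution with parameter `s / A`. -/
def geomMean (s A : ℝ) (f : ℕ → ℝ≥0∞) : ℝ≥0∞ :=
  ∑' n : ℕ, ENNReal.ofReal ((1 - Real.exp (-s / A)) * Real.exp (-s * n / A)) * f n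

lemma one_sub_exp_nonneg {s A : ℝ} (hs : 0 < s) (hA : 0 < A) : 0 ≤ 1 - Real.exp (-s / A) := by
  rw [sub_nonneg, Real.exp_le_one_iff]
  exact div_nonpos_of_nonpos_of_nonneg (by linarith) hA.le

lemma geomMean_one {s A : ℝ} (hs : 0 < s) (hA : 0 < A) : geomMean s A (fun _ => 1) = 1 := by
  have h1 : ∀ n : ℕ, Real.exp (-s * n / A) = Real.exp (-s / A) ^ n := by
    intro n
    rw [← Real.exp_nat_mul]
    congr 1
    ring
  have h2 : Real.exp (-s / A) < 1 := by
    rw [Real.exp_lt_one_iff]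
    exact div_neg_of_neg_of_pos (by linarith) hA
  have h3 : HasSum (fun n : ℕ => (1 - Real.exp (-s / A)) * Real.exp (-s * n / A)) 1 := by
    simp only [h1]
    have := (hasSum_geometric_of_lt_one (Real.exp_pos _).le h2).mul_left (1 - Real.exp (-s / A))
    rwa [mul_inv_cancel₀ (by linarith)] at this
  simp only [geomMean, mul_one]
  rw [← ENNReal.ofReal_tsum_of_nonneg (fun n => mul_nonneg (one_sub_exp_nonneg hs hA)
    (Real.exp_pos _).le) h3.summable, h3.tsum_eq, ENNReal.ofReal_one]

lemma geomMean_eq_lintegral {s A : ℝ} (hs : 0 < s) (hA : 0 < A) (f : ℕ → ℝ≥0∞) :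
    geomMean s A f = ENNReal.ofReal (1 - Real.exp (-s / A)) *
      ∫⁻ t in Set.Ioi (0 : ℝ), ENNReal.ofReal (s * Real.exp (-(s * t))) *
        ∑ j ∈ Finset.range ⌈A * t⌉₊, f j := by
  have h1 : ∀ t : ℝ, ENNReal.ofReal (s * Real.exp (-(s * t))) *
      ∑ j ∈ Finset.range ⌈A * t⌉₊, f j = ∑' j : ℕ, (Set.Ioi (j / A)).indicator
        (fun t => ENNReal.ofReal (s * Real.exp (-(s * t))) * f j) t := by
    intro t
    rw [tsum_eq_sum (s := Finset.range ⌈A * t⌉₊), Finset.mul_sum]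
    · refine Finset.sum_congr rfl fun j hj => ?_
      rw [Finset.mem_range, Nat.lt_ceil] at hj
      rw [Set.indicator_of_mem]
      rwa [Set.mem_Ioi, div_lt_iff₀' hA]
    · intro j hj
      rw [Finset.mem_range, Nat.lt_ceil] at hj
      rw [Set.indicator_of_notMem]
      rwa [Set.mem_Ioi, div_lt_iff₀' hA]
  simp only [h1]
  rw [lintegral_tsum fun j => (Measurable.indicator (by fun_prop) measurableSet_Ioi).aemeasurable,
    ← ENNReal.tsum_mul_left]
  refine tsum_congr fun j => ?_
  rw [lintegral_indicator measurableSet_Ioi, Measure.restrict_restrict measurableSet_Ioi,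
    Set.inter_eq_left.2 (Set.Ioi_subset_Ioi (by positivity)), lintegral_mul_const _ (by fun_prop),
    lintegral_exp_Ioi hs, ← mul_assoc, ← ENNReal.ofReal_mul (one_sub_exp_nonneg hs hA)]
  congr 4
  ring

section Fatou

variable {P : ℕ → ℤ → ℝ≥0∞} {s : ℝ}

lemma eventually_le_occupation (hP : ∀ ε > (0 : ℝ), ∃ n₀ : ℕ, ∀ n ≥ n₀, ∀ k : ℤ,
      ENNReal.ofReal (√n - |(k : ℝ)| - ε * √n) ≤ ∑ j ∈ Finset.range n, P j k)
    (hs : 0 < s) {t : ℝ} (ht : 0 < t) (y : ℝ) {ε : ℝ} (hε : 0 < ε) (hε1 : ε ≤ 1) :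
    ∀ᶠ A : ℝ in atTop, ENNReal.ofReal (s ^ 2 * Real.exp (-(s * t)) * (1 - ε) *
        ((1 - ε) * √t - |y| - ε)) ≤
      ENNReal.ofReal √A * (ENNReal.ofReal (1 - Real.exp (-s / A)) *
        (ENNReal.ofReal (s * Real.exp (-(s * t))) *
          ∑ j ∈ Finset.range ⌈A * t⌉₊, P j ⌊y * √A⌋)) := by
  obtain ⟨n₀, hn₀⟩ := hP ε hε
  have hceil : Tendsto (fun A : ℝ => ⌈A * t⌉₊) atTop atTop :=
    tendsto_nat_ceil_atTop.comp (tendsto_id.atTop_mul_const ht)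
  filter_upwards [hceil.eventually_ge_atTop n₀, eventually_gt_atTop 0,
    Real.tendsto_sqrt_atTop.eventually_ge_atTop (1 / ε), eventually_ge_atTop (s / ε)]
    with A hA hA0 hA1 hA2
  rw [div_le_iff₀ hε] at hA1 hA2
  have h1 := hn₀ _ hA ⌊y * √A⌋
  set n := ⌈A * t⌉₊
  have hsq : √A * √t ≤ √n := by
    rw [← Real.sqrt_mul hA0.le]
    exact Real.sqrt_le_sqrt (Nat.le_ceil _)
  have hk : |(⌊y * √A⌋ : ℝ)| ≤ |y| * √A + 1 := by
    have h2 : |y * √A| = |y| * √A := by rw [abs_mul, abs_of_nonneg (Real.sqrt_nonneg A)]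
    rw [← h2, abs_le]
    have h3 := Int.floor_le (y * √A)
    have h4 := Int.sub_one_lt_floor (y * √A)
    have h5 := abs_le.1 (le_refl |y * √A|)
    constructor <;> linarith
  set Z := (1 - ε) * √t - |y| - ε with hZ
  rcases le_or_gt Z 0 with hZ0 | hZ0
  · rw [ENNReal.ofReal_of_nonpos (mul_nonpos_of_nonneg_of_nonpos
      (mul_nonneg (by positivity) (by linarith)) hZ0)]
    exact zero_le
  have h2 : √A * Z ≤ √n - |(⌊y * √A⌋ : ℝ)| - ε * √n := by
    have : (1 - ε) * (√A * √t) ≤ (1 - ε) * √n :=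
      mul_le_mul_of_nonneg_left hsq (by linarith)
    rw [hZ]
    linarith
  refine le_trans ?_ (mul_le_mul_right (mul_le_mul_right (mul_le_mul_right
    ((ENNReal.ofReal_le_ofReal h2).trans h1) _) _) _)
  rw [← ENNReal.ofReal_mul (by positivity), ← ENNReal.ofReal_mul (one_sub_exp_nonneg hs hA0),
    ← ENNReal.ofReal_mul (Real.sqrt_nonneg A)]
  refine ENNReal.ofReal_le_ofReal ?_
  have h3 : s * (1 - ε) ≤ A * (1 - Real.exp (-s / A)) := by
    have h4 := Real.add_one_le_exp (-s / A)
    have h5 : Real.exp (-s / A) * (1 + s / A) ≤ 1 := by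
      calc Real.exp (-s / A) * (1 + s / A) ≤ Real.exp (-s / A) * Real.exp (s / A) := by
            gcongr
            linarith [Real.add_one_le_exp (s / A)]
        _ = 1 := by rw [← Real.exp_add, neg_div, neg_add_cancel, Real.exp_zero]
    have h6 : s / A ≤ ε := by rw [div_le_iff₀ hA0]; linarith
    have h7 : A * (s / A) = s := by field_simp
    have h8 : 0 ≤ s / A := by positivity
    have h9 : s / A * (1 - ε) ≤ s / A * Real.exp (-s / A) :=
      mul_le_mul_of_nonneg_left (by rw [neg_div] at h4 ⊢; linarith) h8
    calc s * (1 - ε) = A * (s / A * (1 - ε)) := by rw [← mul_assoc, h7]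
      _ ≤ A * (1 - Real.exp (-s / A)) := mul_le_mul_of_nonneg_left (by linarith) hA0.le
  calc s ^ 2 * Real.exp (-(s * t)) * (1 - ε) * Z
      = s * (1 - ε) * (s * Real.exp (-(s * t)) * Z) := by ring
    _ ≤ A * (1 - Real.exp (-s / A)) * (s * Real.exp (-(s * t)) * Z) :=
        mul_le_mul_of_nonneg_right h3 (by positivity)
    _ = √A * √A * (1 - Real.exp (-s / A)) * (s * Real.exp (-(s * t)) * Z) := by
        rw [Real.mul_self_sqrt hA0.le]
    _ = _ := by ring

lemma expDensity_le_liminf (hP : ∀ ε > (0 : ℝ), ∃ n₀ : ℕ, ∀ n ≥ n₀, ∀ k : ℤ,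
      ENNReal.ofReal (√n - |(k : ℝ)| - ε * √n) ≤ ∑ j ∈ Finset.range n, P j k)
    (hs : 0 < s) (y : ℝ) :
    expDensity s y ≤ liminf (fun A : ℝ => ENNReal.ofReal √A *
      geomMean s A (fun n => P n ⌊y * √A⌋)) atTop := by
  have hmeas : ∀ A : ℝ, Measurable fun t : ℝ => ENNReal.ofReal (s * Real.exp (-(s * t))) *
      ∑ j ∈ Finset.range ⌈A * t⌉₊, P j ⌊y * √A⌋ := by
    intro A
    refine Measurable.mul (by fun_prop) ?_
    exact (measurable_from_nat (f := fun n => ∑ j ∈ Finset.range n, P j ⌊y * √A⌋)).comp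
      (Nat.measurable_ceil.comp (by fun_prop))
  have h1 : ∀ᶠ A : ℝ in atTop, ENNReal.ofReal √A * geomMean s A (fun n => P n ⌊y * √A⌋) =
      ∫⁻ t in Set.Ioi (0 : ℝ), ENNReal.ofReal √A * (ENNReal.ofReal (1 - Real.exp (-s / A)) *
        (ENNReal.ofReal (s * Real.exp (-(s * t))) *
          ∑ j ∈ Finset.range ⌈A * t⌉₊, P j ⌊y * √A⌋)) := by
    filter_upwards [eventually_gt_atTop 0] with A hA
    rw [geomMean_eq_lintegral hs hA, lintegral_const_mul _ ((hmeas A).const_mul _),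
      lintegral_const_mul _ (hmeas A)]
  rw [liminf_congr h1]
  refine le_trans ?_ (lintegral_liminf_le fun A => ((hmeas A).const_mul _).const_mul _)
  refine setLIntegral_mono' measurableSet_Ioi fun t ht => ?_
  have hcont : Continuous fun ε : ℝ => ENNReal.ofReal (s ^ 2 * Real.exp (-(s * t)) * (1 - ε) *
      ((1 - ε) * √t - |y| - ε)) :=
    ENNReal.continuous_ofReal.comp (by fun_prop)
  have hlim := (hcont.tendsto 0).mono_left (nhdsWithin_le_nhds (s := Set.Ioi 0))
  simp only [sub_zero, mul_one, one_mul] at hlim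
  refine le_of_tendsto hlim ?_
  filter_upwards [Ioc_mem_nhdsGT (zero_lt_one' ℝ)] with ε hε
  exact le_liminf_of_le (by isBoundedDefault) (eventually_le_occupation hP hs ht y hε.1 hε.2)

lemma lintegral_floor_mul {a : ℝ} (ha : 0 < a) (f : ℤ → ℝ≥0∞) :
    ∫⁻ y : ℝ, ENNReal.ofReal a * f ⌊y * a⌋ = ∑' k, f k := by
  have h1 : ∀ y : ℝ, ENNReal.ofReal a * f ⌊y * a⌋ =
      ∑' k : ℤ, (Set.Ico (k / a) ((k + 1) / a)).indicator (fun _ => ENNReal.ofReal a * f k) y := by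
    intro y
    have hmem : ∀ k : ℤ, y ∈ Set.Ico (k / a) ((k + 1) / a) ↔ ⌊y * a⌋ = k := by
      intro k
      rw [Set.mem_Ico, div_le_iff₀ ha, lt_div_iff₀ ha, Int.floor_eq_iff]
    rw [tsum_eq_single ⌊y * a⌋, Set.indicator_of_mem ((hmem _).2 rfl)]
    intro k hk
    rw [Set.indicator_of_notMem (fun h => hk ((hmem k).1 h).symm)]
  simp only [h1]
  rw [lintegral_tsum fun k => (measurable_const.indicator measurableSet_Ico).aemeasurable]
  refine tsum_congr fun k => ?_
  rw [lintegral_indicator measurableSet_Ico, setLIntegral_const, Real.volume_Ico, mul_right_comm,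
    ← ENNReal.ofReal_mul ha.le, ← sub_div, add_sub_cancel_left, mul_one_div_cancel ha.ne',
    ENNReal.ofReal_one, one_mul]

lemma setLIntegral_expDensity_le (hP : ∀ ε > (0 : ℝ), ∃ n₀ : ℕ, ∀ n ≥ n₀, ∀ k : ℤ,
      ENNReal.ofReal (√n - |(k : ℝ)| - ε * √n) ≤ ∑ j ∈ Finset.range n, P j k)
    (hs : 0 < s) {S : Set ℝ} (hS : MeasurableSet S) (T : ℝ → Set ℤ)
    (hT : ∀ y ∈ S, ∀ᶠ A : ℝ in atTop, ⌊y * √A⌋ ∈ T A) :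
    ∫⁻ y in S, expDensity s y ≤
      liminf (fun A => geomMean s A fun n => ∑' k, (T A).indicator (P n) k) atTop := by
  have h1 : ∀ᶠ A : ℝ in atTop, geomMean s A (fun n => ∑' k, (T A).indicator (P n) k) =
      ∫⁻ y : ℝ, ENNReal.ofReal √A * geomMean s A (fun n => (T A).indicator (P n) ⌊y * √A⌋) := by
    filter_upwards [eventually_gt_atTop 0] with A hA
    rw [lintegral_floor_mul (Real.sqrt_pos.2 hA)
      (fun k => geomMean s A fun n => (T A).indicator (P n) k)]
    simp only [geomMean, ← ENNReal.tsum_mul_left]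
    exact ENNReal.tsum_comm
  rw [liminf_congr h1]
  have hmeas : ∀ A : ℝ, Measurable fun y : ℝ =>
      ENNReal.ofReal √A * geomMean s A (fun n => (T A).indicator (P n) ⌊y * √A⌋) := by
    intro A
    refine Measurable.const_mul ?_ _
    exact (measurable_of_countable
      (fun k : ℤ => geomMean s A fun n => (T A).indicator (P n) k)).comp
      (Int.measurable_floor.comp (by fun_prop))
  refine le_trans ?_ (lintegral_liminf_le hmeas)
  refine le_trans ?_ (setLIntegral_le_lintegral S _)
  refine setLIntegral_mono' hS fun y hy => (expDensity_le_liminf hP hs y).trans_eq ?_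
  refine liminf_congr ?_
  filter_upwards [hT y hy] with A hA
  simp only [Set.indicator_of_mem hA]

end Fatou

lemma tendsto_of_le_liminf_of_add_eq {ι : Type*} {l : Filter ι} [l.NeBot] {a b : ι → ℝ≥0∞}
    {α β c : ℝ≥0∞} (hc : c ≠ ⊤) (hab : ∀ᶠ i in l, a i + b i = c) (hαβ : α + β = c)
    (ha : α ≤ liminf a l) (hb : β ≤ liminf b l) : Tendsto a l (𝓝 α) := by
  have hβ : β ≠ ⊤ := ne_top_of_le_ne_top hc (hαβ ▸ le_add_self)
  refine tendsto_of_le_liminf_of_limsup_le ha ?_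
  calc limsup a l = limsup (fun i => c - b i) l := by
        refine limsup_congr ?_
        filter_upwards [hab] with i hi
        exact ENNReal.eq_sub_of_add_eq (ne_top_of_le_ne_top hc (hi ▸ le_add_self)) hi
    _ = c - liminf b l := ENNReal.limsup_const_sub l b hc
    _ ≤ c - β := tsub_le_tsub_left hb c
    _ = α := (ENNReal.eq_sub_of_add_eq hβ hαβ).symm

lemma geomMean_add (s A : ℝ) (f g : ℕ → ℝ≥0∞) :
    geomMean s A f + geomMean s A g = geomMean s A fun n => f n + g n := by
  simp only [geomMean, ← ENNReal.tsum_add, mul_add]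

lemma toReal_geomMean {s A : ℝ} (hs : 0 < s) (hA : 0 < A) {f : ℕ → ℝ≥0∞} (hf : ∀ n, f n ≠ ⊤) :
    (geomMean s A f).toReal =
      (1 - Real.exp (-s / A)) * ∑' n : ℕ, Real.exp (-s * n / A) * (f n).toReal := by
  rw [geomMean, ENNReal.tsum_toReal_eq fun n => ENNReal.mul_ne_top ENNReal.ofReal_ne_top (hf n),
    ← tsum_mul_left]
  refine tsum_congr fun n => ?_
  rw [ENNReal.toReal_mul, ENNReal.toReal_ofReal (mul_nonneg (one_sub_exp_nonneg hs hA)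
    (Real.exp_pos _).le), mul_assoc]

lemma phiHat_nonneg (s y : ℝ) : 0 ≤ phiHat s y := by
  rw [phiHat, one_sub_stdNormalCdf]
  have : 0 ≤ ∫ u in Set.Ioi (√(2 * s) * |y|), Real.exp (-(u ^ 2) / 2) :=
    integral_nonneg fun u => (Real.exp_pos _).le
  positivity

lemma measurable_expDensity (s : ℝ) : Measurable (expDensity s) := by
  unfold expDensity
  exact Measurable.lintegral_prod_right (by fun_prop)

lemma integral_phiHat {s : ℝ} (hs : 0 < s) (x : ℝ) :
    ∫ y in Set.Iio x, phiHat s y = (∫⁻ y in Set.Iio x, expDensity s y).toReal := by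
  rw [← integral_toReal (measurable_expDensity s).aemeasurable]
  · simp only [expDensity_eq_phiHat hs, ENNReal.toReal_ofReal (phiHat_nonneg s _)]
  · refine ae_of_all _ fun y => ?_
    rw [expDensity_eq_phiHat hs]
    exact ENNReal.ofReal_lt_top

/-- integral limit theorem at an independent geometric time:
`Pr(A^{-1/2} X(θ_{s/A}) < x) → ∫_{-∞}^x φ̂(s,y) dy` as `A → ∞`, for every `x`.
Here `Pr(A^{-1/2} X(θ_{s/A}) < x) = (1 - e^{-s/A}) ∑_n e^{-sn/A} Pr(A^{-1/2} X(n) < x)`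
since `θ_{s/A}` is geometric and independent of `X`. -/
theorem stmt_18 (w : ℤ → ℝ) (hw : GoodWeight w)
    {Ω : Type*} [MeasurableSpace Ω] (μ : Measure Ω) [IsProbabilityMeasure μ]
    (X : ℕ → Ω → ℤ) (hX : IsSRW μ w X) (s : ℝ) (hs : 0 < s) :
    ∀ x : ℝ,
      Tendsto (fun A : ℝ => (1 - Real.exp (-s / A)) *
          ∑' n : ℕ, Real.exp (-s * n / A) *
            (μ {ω | (Real.sqrt A)⁻¹ * (X n ω : ℝ) < x}).toReal)
        atTop (𝓝 (∫ y in Set.Iio x, phiHat s y)) := by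
  intro x
  have hP : ∀ ε > (0 : ℝ), ∃ n₀ : ℕ, ∀ n ≥ n₀, ∀ k : ℤ,
      ENNReal.ofReal (√n - |(k : ℝ)| - ε * √n) ≤
        ∑ j ∈ Finset.range n, μ {ω | X j ω = k} := by
    intro ε hε
    simp only [hX.measure_eq_expect]
    exact WalkState.le_sum_expect_pos hw hε
  have hsum : ∀ (n : ℕ) (T : Set ℤ),
      ∑' k, T.indicator (fun k => μ {ω | X n ω = k}) k = μ (X n ⁻¹' T) := by
    intro n T
    rw [← tsum_subtype, ← tsum_measure_preimage_singleton T.to_countable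
      fun k _ => hX.1 n (measurableSet_singleton k)]
    rfl
  set T : ℝ → Set ℤ := fun A => {k | (√A)⁻¹ * (k : ℝ) < x} with hT
  have hα := setLIntegral_expDensity_le hP hs (measurableSet_Iio (a := x)) T fun y hy => by
    filter_upwards [eventually_gt_atTop 0] with A hA
    have hA' := Real.sqrt_pos.2 hA
    rw [hT, Set.mem_ofPred_eq, inv_mul_lt_iff₀ hA', mul_comm √A]
    exact (Int.floor_le _).trans_lt (mul_lt_mul_of_pos_right hy hA')
  have hβ := setLIntegral_expDensity_le hP hs (measurableSet_Ioi (a := x)) (fun A => (T A)ᶜ)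
    fun y hy => by
      have hy' : 0 < y - x := sub_pos.2 hy
      filter_upwards [eventually_gt_atTop 0,
        Real.tendsto_sqrt_atTop.eventually_ge_atTop (1 / (y - x))] with A hA hA1
      have hA' := Real.sqrt_pos.2 hA
      rw [div_le_iff₀ hy'] at hA1
      rw [Set.mem_compl_iff, hT, Set.mem_ofPred_eq, inv_mul_lt_iff₀ hA', not_lt]
      linarith [Int.sub_one_lt_floor (y * √A)]
  simp only [hsum] at hα hβ
  have hab : ∀ᶠ A : ℝ in atTop, geomMean s A (fun n => μ (X n ⁻¹' T A)) +
      geomMean s A (fun n => μ (X n ⁻¹' (T A)ᶜ)) = 1 := by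
    filter_upwards [eventually_gt_atTop 0] with A hA
    rw [geomMean_add, ← geomMean_one hs hA]
    congr 1
    funext n
    rw [Set.preimage_compl, prob_add_prob_compl (hX.1 n (Set.to_countable _).measurableSet)]
  have hαβ : (∫⁻ y in Set.Iio x, expDensity s y) + ∫⁻ y in Set.Ioi x, expDensity s y = 1 := by
    rw [setLIntegral_congr Ioi_ae_eq_Ici, ← Set.compl_Iio,
      lintegral_add_compl _ measurableSet_Iio, lintegral_expDensity hs]
  have hlim := tendsto_of_le_liminf_of_add_eq ENNReal.one_ne_top hab hαβ hα hβ
  have hα_top : ∫⁻ y in Set.Iio x, expDensity s y ≠ ⊤ :=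
    ne_top_of_le_ne_top ENNReal.one_ne_top (hαβ ▸ le_self_add)
  rw [integral_phiHat hs]
  refine ((ENNReal.tendsto_toReal hα_top).comp hlim).congr' ?_
  filter_upwards [eventually_gt_atTop 0] with A hA
  rw [Function.comp_apply, toReal_geomMean hs hA fun n => measure_ne_top μ _]
  rfl
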